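/- arXiv:1510.04727 — 2 statements merged into one kernel-verified Lean document; each statement's English description precedes it below -/
import Mathlib

section
/- There exists an absolute constant C₁ ≤ 32.42 such that for every n and every n×n complex Hermitian positive semi-definite matrix B with unit diagonal there exists a permutation σ of {1,…,n} for which the strictly lower triangular part L_σ of B_σ = P_σ B P_σ* satisfies ‖L_σ‖ ≤ C₁‖B‖. -/
open Matrix
open scoped ComplexOrder

/-- Spectral (operator ℓ²→ℓ²) norm of a complex square matrix. -/
noncomputable def specNorm {n : ℕ} (M : Matrix (Fin n) (Fin n) ℂ) : ℝ :=
  ‖Matrix.toEuclideanCLM (𝕜 := ℂ) (n := Fin n) M‖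

/-- Strictly lower triangular part of a matrix. -/
def lowerTri {n : ℕ} (M : Matrix (Fin n) (Fin n) ℂ) : Matrix (Fin n) (Fin n) ℂ :=
  Matrix.of fun i j => if j < i then M i j else 0

/-- Squared energy seminorm |y|_B² = ⟨By, y⟩. -/
noncomputable def energySq {n : ℕ} (B : Matrix (Fin n) (Fin n) ℂ) (y : Fin n → ℂ) : ℝ :=
  (star y ⬝ᵥ (B *ᵥ y)).re

/-- Euclidean norm of a vector in ℂⁿ. -/
noncomputable def euclNorm {n : ℕ} (v : Fin n → ℂ) : ℝ :=
  ‖(WithLp.equiv 2 (Fin n → ℂ)).symm v‖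

section

open Polynomial ComplexConjugate

/-- If `C / f` maps the upper half-plane to the lower one, then a root of `f` at which `C` does not
vanish is simple and has a positive residue. -/
lemma derivative_mul_pos_of_isRoot {f g : ℝ[X]} {ρ : ℝ} (hf0 : f ≠ 0) (hρ : f.eval ρ = 0)
    (hg : g.eval ρ ≠ 0)
    (him : ∀ s : ℂ, 0 < s.im → (aeval s g * conj (aeval s f)).im ≤ 0) :
    0 < g.eval ρ * f.derivative.eval ρ := by
  obtain ⟨q, hq, hndvd⟩ := exists_eq_pow_rootMultiplicity_mul_and_not_dvd f hf0 ρ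
  set m := f.rootMultiplicity ρ with hm
  have hm1 : 0 < m := (rootMultiplicity_pos hf0).2 hρ
  have hqρ : q.eval ρ ≠ 0 := fun h => hndvd (dvd_iff_isRoot.2 h)
  have aevalρ : ∀ p : ℝ[X], aeval (ρ : ℂ) p = ((p.eval ρ : ℝ) : ℂ) := fun p => by
    rw [← Complex.coe_algebraMap, aeval_algebraMap_apply, coe_aeval_eq_eval]
  have key : ∀ u : ℂ, 0 < u.im → g.eval ρ * q.eval ρ * (conj (u ^ m)).im ≤ 0 := by
    intro u hu
    have hcont : Continuous fun ε : ℝ =>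
        (aeval ((ρ : ℂ) + ε * u) g * conj (aeval ((ρ : ℂ) + ε * u) q) * conj (u ^ m)).im := by
      have h1 : ∀ p : ℝ[X], Continuous fun ε : ℝ => aeval ((ρ : ℂ) + ε * u) p := fun p =>
        p.continuous_aeval.comp (by fun_prop)
      have h2 : Continuous fun ε : ℝ => conj (aeval ((ρ : ℂ) + ε * u) q) :=
        Complex.continuous_conj.comp (h1 q)
      exact Complex.continuous_im.comp (((h1 g).mul h2).mul continuous_const)
    have h0 : ∀ ε : ℝ, 0 < ε →
        (aeval ((ρ : ℂ) + ε * u) g * conj (aeval ((ρ : ℂ) + ε * u) q) * conj (u ^ m)).im ≤ 0 := by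
      intro ε hε
      have := him (ρ + ε * u) (by simp [hu, hε])
      rw [hq] at this
      have e : aeval ((ρ : ℂ) + ε * u) g *
          conj (aeval ((ρ : ℂ) + ε * u) ((X - C ρ) ^ m * q)) =
          ((ε ^ m : ℝ) : ℂ) * (aeval ((ρ : ℂ) + ε * u) g * conj (aeval ((ρ : ℂ) + ε * u) q) *
            conj (u ^ m)) := by
        simp [mul_pow]; ring
      rw [e, Complex.im_ofReal_mul] at this
      exact nonpos_of_mul_nonpos_right this (pow_pos hε m)
    have hlim := (hcont.tendsto 0).mono_left (nhdsWithin_le_nhds (s := Set.Ioi 0))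
    have := le_of_tendsto hlim (Filter.eventually_of_mem self_mem_nhdsWithin h0)
    simpa [aevalρ, ← Complex.ofReal_mul] using this
  have hm_one : m = 1 := by
    by_contra hne
    have hm2 : (2 : ℝ) ≤ m := by exact_mod_cast (by omega : 2 ≤ m)
    have hmne : (m : ℂ) ≠ 0 := by exact_mod_cast hm1.ne'
    have hexp : ∀ t : ℝ, (Complex.exp ((t / m : ℝ) * Complex.I)) ^ m
        = Complex.exp (t * Complex.I) := by
      intro t
      rw [← Complex.exp_nat_mul]; congr 1; push_cast; field_simp
    have him' : ∀ t : ℝ, 0 < t → t < 2 * Real.pi →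
        0 < (Complex.exp ((t / m : ℝ) * Complex.I)).im := by
      intro t ht ht2
      rw [Complex.exp_ofReal_mul_I_im]
      apply Real.sin_pos_of_pos_of_lt_pi (by positivity)
      rw [div_lt_iff₀ (by linarith)]
      nlinarith [Real.pi_pos]
    have h1 := key _ (him' (Real.pi / 2) (by positivity) (by linarith [Real.pi_pos]))
    have h2 := key _ (him' (Real.pi / 2 + Real.pi) (by positivity) (by linarith [Real.pi_pos]))
    rw [hexp, Complex.conj_im, Complex.exp_ofReal_mul_I_im] at h1 h2
    rw [Real.sin_add_pi] at h2
    simp only [Real.sin_pi_div_two] at h1 h2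
    have := mul_ne_zero hg hqρ
    apply this; linarith
  have h1 := key Complex.I (by simp)
  rw [hm_one] at h1 hq
  simp only [pow_one, Complex.conj_I, Complex.neg_im, Complex.I_im] at h1
  have hd : f.derivative.eval ρ = q.eval ρ := by rw [hq]; simp
  rw [hd]
  exact lt_of_le_of_ne (by linarith) (mul_ne_zero hg hqρ).symm

lemma splits_of_aeval_ne_zero {f : ℝ[X]} (hroots : ∀ s : ℂ, 0 < s.im → aeval s f ≠ 0) :
    f.Splits := by
  apply Splits.of_splits_map (algebraMap ℝ ℂ) (IsAlgClosed.splits _)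
  intro a ha
  have ha0 : aeval a f = 0 := by
    rw [mem_roots'] at ha
    simpa [aeval_def, eval_map] using ha.2
  refine ⟨a.re, ?_⟩
  have : a.im = 0 := by
    rcases lt_trichotomy a.im 0 with h | h | h
    · exact absurd (by rw [aeval_conj, ha0, map_zero]) (hroots (conj a) (by simpa using h))
    · exact h
    · exact absurd ha0 (hroots a h)
  apply Complex.ext <;> simp [this]

/-- `convexDefect f g a = f(0) f(a)² (h(0) - h(a) + a (dh/dx)(a))` for `h = g / f`. -/
noncomputable def convexDefect (f g : ℝ[X]) (a : ℝ) : ℝ :=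
  g.eval 0 * f.eval a ^ 2 - f.eval 0 * (g.eval a * f.eval a -
    a * (g.derivative.eval a * f.eval a - g.eval a * f.derivative.eval a))

lemma convexDefect_nonneg_of_no_common_root {f g : ℝ[X]} {a : ℝ} (ha : 0 < a)
    (hroots : ∀ s : ℂ, 0 < s.im → aeval s f ≠ 0) (hpos : ∀ s, 0 ≤ s → 0 < f.eval s)
    (hdeg : g.degree ≤ f.degree)
    (him : ∀ s : ℂ, 0 < s.im → (aeval s g * conj (aeval s f)).im ≤ 0)
    (hcommon : ∀ ρ, f.eval ρ = 0 → g.eval ρ ≠ 0) : 0 ≤ convexDefect f g a := by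
  classical
  have hf0 : f ≠ 0 := by rintro rfl; simpa using hpos 0 le_rfl
  have hres : ∀ ρ, f.eval ρ = 0 → 0 < g.eval ρ * f.derivative.eval ρ := fun ρ hρ =>
    derivative_mul_pos_of_isRoot hf0 hρ (hcommon ρ hρ) him
  have hder : ∀ ρ, f.eval ρ = 0 → f.derivative.eval ρ ≠ 0 := fun ρ hρ h => by
    have := hres ρ hρ; simp [h] at this
  have hnodup : f.roots.Nodup := by
    rw [Multiset.nodup_iff_count_le_one]
    intro ρ
    rw [count_roots]
    by_contra! h
    have := (one_lt_rootMultiplicity_iff_isRoot hf0).1 h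
    exact hder ρ this.1 this.2
  set R := f.roots.toFinset with hR
  have hRmem : ∀ ρ, ρ ∈ R ↔ f.eval ρ = 0 := fun ρ => by simp [hR, hf0]
  have hcard : (R.card : WithBot ℕ) = f.degree := by
    rw [hR, Multiset.toFinset_card_of_nodup hnodup,
      ← (splits_of_aeval_ne_zero hroots).natDegree_eq_card_roots, degree_eq_natDegree hf0]
  have hquot : ∀ ρ, ∃ q : ℝ[X], f.eval ρ = 0 → f = (X - C ρ) * q := fun ρ => by
    by_cases h : f.eval ρ = 0
    · obtain ⟨q, hq⟩ := dvd_iff_isRoot.2 h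
      exact ⟨q, fun _ => hq⟩
    · exact ⟨0, fun h' => absurd h' h⟩
  choose q hq using hquot
  set c : ℝ := g.coeff f.natDegree / f.leadingCoeff with hc
  have hsum : g = C c * f + ∑ ρ ∈ R, C (g.eval ρ / f.derivative.eval ρ) * q ρ := by
    rw [← sub_eq_iff_eq_add']
    apply eq_of_degrees_lt_of_eval_finset_eq R
    · rw [hcard]
      refine lt_of_le_of_ne ?_ ?_
      · refine (degree_sub_le _ _).trans (max_le hdeg ?_)
        exact C_mul' c f ▸ degree_smul_le c f
      · intro h
        have h1 : (g - C c * f).natDegree = f.natDegree := natDegree_eq_of_degree_eq h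
        have h2 : (g - C c * f).coeff f.natDegree = 0 := by
          rw [coeff_sub, coeff_C_mul, hc, coeff_natDegree,
            div_mul_cancel₀ _ (leadingCoeff_ne_zero.2 hf0), sub_self]
        rw [← h1, coeff_natDegree, leadingCoeff_eq_zero] at h2
        rw [h2, degree_zero] at h
        exact hf0 (degree_eq_bot.1 h.symm)
    · rw [hcard]
      refine (degree_sum_le _ _).trans_lt ((Finset.sup_lt_iff ?_).2 ?_)
      · exact bot_lt_iff_ne_bot.2 (by simpa using hf0)
      · intro ρ hρ
        have e := hq ρ ((hRmem ρ).1 hρ)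
        have hq0 : q ρ ≠ 0 := by intro h; rw [h, mul_zero] at e; exact hf0 e
        refine (C_mul' _ (q ρ) ▸ degree_smul_le _ (q ρ)).trans_lt ?_
        conv_rhs => rw [e]
        rw [degree_mul, degree_X_sub_C, degree_eq_natDegree hq0]
        norm_cast; omega
    · intro ρ hρ
      have hρ0 := (hRmem ρ).1 hρ
      rw [eval_sub, eval_mul, hρ0, mul_zero, sub_zero, eval_finsetSum,
        Finset.sum_eq_single_of_mem ρ hρ]
      · have e := congrArg (fun p : ℝ[X] => p.derivative.eval ρ) (hq ρ hρ0)
        simp at e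
        rw [eval_mul, eval_C, ← e, div_mul_cancel₀ _ (hder ρ hρ0)]
      · intro b hb hbρ
        have e := congrArg (fun p : ℝ[X] => p.eval ρ) (hq b ((hRmem b).1 hb))
        simp only [hρ0, eval_mul, eval_sub, eval_X, eval_C] at e
        rcases mul_eq_zero.1 e.symm with h | h
        · exact absurd (sub_eq_zero.1 h).symm hbρ
        · simp [h]
  have hlin : convexDefect f g a = ∑ ρ ∈ R, g.eval ρ / f.derivative.eval ρ *
      convexDefect f (q ρ) a := by
    have e0 := congrArg (fun p : ℝ[X] => p.eval 0) hsum
    have ea := congrArg (fun p : ℝ[X] => p.eval a) hsum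
    have ed := congrArg (fun p : ℝ[X] => p.derivative.eval a) hsum
    simp only [eval_add, eval_mul, eval_C, eval_finsetSum, derivative_add, derivative_mul,
      derivative_C, derivative_sum, zero_mul, zero_add] at e0 ea ed
    simp only [convexDefect, e0, ea, ed, mul_sub, Finset.sum_sub_distrib]
    simp only [add_mul, mul_add, Finset.sum_mul, Finset.mul_sum]
    have : ∀ A B D E A' B' D' E': ℝ, A = A' → B = B' → D = D' → E = E' →
      A - (B - (D - E)) = A' - (B' - (D' - E')) := by
        rintro _ _ _ _ _ _ _ _ rfl rfl rfl rfl; rfl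
    have s1 : ∑ ρ ∈ R, g.eval ρ / f.derivative.eval ρ * ((q ρ).eval 0 * f.eval a ^ 2) =
      ∑ ρ ∈ R, g.eval ρ / f.derivative.eval ρ * (q ρ).eval 0 * f.eval a ^ 2 :=
        Finset.sum_congr rfl fun _ _ => by ring
    have s2 : ∑ ρ ∈ R, g.eval ρ / f.derivative.eval ρ * (f.eval 0 * ((q ρ).eval a * f.eval a)) =
      ∑ ρ ∈ R, f.eval 0 * (g.eval ρ / f.derivative.eval ρ * (q ρ).eval a * f.eval a) :=
        Finset.sum_congr rfl fun _ _ => by ring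
    have s3 : ∑ ρ ∈ R, g.eval ρ / f.derivative.eval ρ *
        (f.eval 0 * (a * ((q ρ).derivative.eval a * f.eval a))) =
      ∑ ρ ∈ R, f.eval 0 * (a * (g.eval ρ / f.derivative.eval ρ * (q ρ).derivative.eval a *
        f.eval a)) :=
        Finset.sum_congr rfl fun _ _ => by ring
    have s4 : ∑ ρ ∈ R, g.eval ρ / f.derivative.eval ρ *
        (f.eval 0 * (a * ((q ρ).eval a * f.derivative.eval a))) =
      ∑ ρ ∈ R, f.eval 0 * (a * (g.eval ρ / f.derivative.eval ρ * (q ρ).eval a *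
        f.derivative.eval a)) :=
        Finset.sum_congr rfl fun _ _ => by ring
    rw [s1, s2, s3, s4]
    ring
  rw [hlin]
  refine Finset.sum_nonneg fun ρ hρ => ?_
  have hρ0 := (hRmem ρ).1 hρ
  have hρneg : ρ < 0 := by
    by_contra! h
    exact (hpos ρ h).ne' hρ0
  refine mul_nonneg ?_ ?_
  · rcases div_nonneg_iff.2 (mul_nonneg_iff.1 (hres ρ hρ0).le) with h
    exact h
  · have e0 := congrArg (fun p : ℝ[X] => p.eval 0) (hq ρ hρ0)
    have ea := congrArg (fun p : ℝ[X] => p.eval a) (hq ρ hρ0)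
    have ed := congrArg (fun p : ℝ[X] => p.derivative.eval a) (hq ρ hρ0)
    simp only [eval_mul, eval_sub, eval_X, eval_C, derivative_mul, derivative_sub, derivative_X,
      derivative_C, eval_add, sub_zero, one_mul, zero_sub] at e0 ea ed
    have hq0 : 0 < (q ρ).eval 0 := by
      have := hpos 0 le_rfl
      rw [e0] at this
      exact pos_of_mul_pos_right this (by linarith)
    rw [convexDefect, e0, ea, ed]
    have : (q ρ).eval 0 * ((a - ρ) * (q ρ).eval a) ^ 2 - -ρ * (q ρ).eval 0 *
        ((q ρ).eval a * ((a - ρ) * (q ρ).eval a) - a * ((q ρ).derivative.eval a *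
        ((a - ρ) * (q ρ).eval a) - (q ρ).eval a * ((q ρ).eval a + (a - ρ) *
        (q ρ).derivative.eval a))) = (q ρ).eval 0 * (q ρ).eval a ^ 2 * a ^ 2 := by ring
    rw [this]
    positivity

/-- If `g / f` maps the upper half-plane to the lower one and the real-rooted polynomial `f` is
positive on `[0, ∞)`, then `g / f` is convex there. -/
lemma convexDefect_nonneg {a : ℝ} (ha : 0 < a) {f g : ℝ[X]}
    (hroots : ∀ s : ℂ, 0 < s.im → aeval s f ≠ 0) (hpos : ∀ s, 0 ≤ s → 0 < f.eval s)
    (hdeg : g.degree ≤ f.degree)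
    (him : ∀ s : ℂ, 0 < s.im → (aeval s g * conj (aeval s f)).im ≤ 0) :
    0 ≤ convexDefect f g a := by
  induction hn : f.natDegree using Nat.strong_induction_on generalizing f g with
  | _ n ih =>
  by_cases hcommon : ∀ ρ, f.eval ρ = 0 → g.eval ρ ≠ 0
  · exact convexDefect_nonneg_of_no_common_root ha hroots hpos hdeg him hcommon
  push Not at hcommon
  obtain ⟨ρ, hfρ, hgρ⟩ := hcommon
  have hρneg : ρ < 0 := by
    by_contra! h
    exact (hpos ρ h).ne' hfρ
  obtain ⟨f₁, rfl⟩ := dvd_iff_isRoot.2 hfρ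
  obtain ⟨g₁, rfl⟩ := dvd_iff_isRoot.2 hgρ
  have hf₁ : f₁ ≠ 0 := by rintro rfl; simpa using hpos 0 le_rfl
  have h1 : 0 ≤ convexDefect f₁ g₁ a := by
    refine ih f₁.natDegree ?_ (fun s hs h => hroots s hs (by simp [h])) (fun s hs => ?_) ?_
      (fun s hs => ?_) rfl
    · rw [← hn, natDegree_mul (X_sub_C_ne_zero ρ) hf₁, natDegree_X_sub_C]; omega
    · have := hpos s hs
      simp only [eval_mul, eval_sub, eval_X, eval_C] at this
      exact pos_of_mul_pos_right this (by linarith)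
    · rw [degree_mul, degree_mul, degree_X_sub_C] at hdeg
      by_cases hg₁ : g₁ = 0
      · simp [hg₁]
      rw [degree_eq_natDegree hf₁, degree_eq_natDegree hg₁] at hdeg ⊢
      norm_cast at hdeg ⊢; omega
    · have h := him s hs
      have e : aeval s ((X - C ρ) * g₁) * conj (aeval s ((X - C ρ) * f₁)) =
          ((Complex.normSq (s - ρ) : ℝ) : ℂ) * (aeval s g₁ * conj (aeval s f₁)) := by
        rw [Complex.normSq_eq_conj_mul_self]
        simp; ring
      rw [e, Complex.im_ofReal_mul] at h
      refine nonpos_of_mul_nonpos_right h (Complex.normSq_pos.2 fun h0 => ?_)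
      have := congrArg Complex.im h0
      simp at this; linarith
  have : convexDefect ((X - C ρ) * f₁) ((X - C ρ) * g₁) a =
      (-ρ) * (a - ρ) ^ 2 * convexDefect f₁ g₁ a := by
    simp only [convexDefect, eval_mul, eval_sub, eval_X, eval_C, derivative_mul, derivative_sub,
      derivative_X, derivative_C, eval_add, sub_zero, one_mul, zero_sub]
    ring
  rw [this]
  exact mul_nonneg (mul_nonneg (by linarith) (sq_nonneg _)) h1

lemma degree_le_of_bounded {f g : ℝ[X]} {M : ℝ} (hpos : ∀ s, 0 ≤ s → 0 < f.eval s)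
    (hg : ∀ s, 0 ≤ s → 0 ≤ g.eval s) (hM : ∀ s, 0 ≤ s → g.eval s ≤ M * f.eval s) :
    g.degree ≤ f.degree := by
  by_contra! h
  have hf0 : f ≠ 0 := by rintro rfl; simpa using hpos 0 le_rfl
  have := abs_div_tendsto_atTop_atTop_of_degree_gt g f h hf0
  obtain ⟨s, hs, hs0⟩ := ((this.eventually_gt_atTop M).and
    (Filter.eventually_ge_atTop 0)).exists
  rw [abs_of_nonneg (div_nonneg (hg s hs0) (hpos s hs0).le), lt_div_iff₀ (hpos s hs0)] at hs
  linarith [hM s hs0]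

namespace StableFun

variable {κ : Type*} [DecidableEq κ]

/-- The difference operator in the `k`-th coordinate; it is the partial derivative of a function
which is affine in that coordinate. -/
def dd (k : κ) (F : (κ → ℂ) → ℂ) (z : κ → ℂ) : ℂ := F (z + Pi.single k 1) - F z

/-- Coercion of real vectors. -/
def ofR (x : κ → ℝ) : κ → ℂ := fun k => (x k : ℂ)

/-- The restriction of `F` to real points. -/
def re (F : (κ → ℂ) → ℂ) (x : κ → ℝ) : ℝ := (F (ofR x)).re

/-- The operator `1 - w ∑ k ∈ J, ∂ₖ`. -/
noncomputable def oneSub (w : ℝ) (J : Finset κ) (F : (κ → ℂ) → ℂ) (z : κ → ℂ) : ℂ :=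
  F z - w * ∑ k ∈ J, dd k F z

/-- Real stable functions which are affine in each variable. -/
structure Stable (F : (κ → ℂ) → ℂ) : Prop where
  affine : ∀ z k t, F (z + Pi.single k t) = F z + t * dd k F z
  real : ∀ x : κ → ℝ, (F (ofR x)).im = 0
  cont : Continuous F
  ne_zero : ∀ z, (∀ k, 0 < (z k).im) → F z ≠ 0

lemma ofR_add_single (x : κ → ℝ) (k : κ) (t : ℝ) :
    ofR (x + Pi.single k t) = ofR x + Pi.single k (t : ℂ) := by
  ext j; by_cases h : j = k
  · subst h; simp [ofR]
  · simp [ofR, h]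

lemma dd_comm (k l : κ) (F : (κ → ℂ) → ℂ) : dd k (dd l F) = dd l (dd k F) := by
  ext z; simp only [dd]; rw [add_right_comm]; ring

lemma dd_oneSub (w : ℝ) (J : Finset κ) (k : κ) (F : (κ → ℂ) → ℂ) :
    dd k (oneSub w J F) = oneSub w J (dd k F) := by
  ext z
  rw [oneSub, Finset.sum_congr rfl fun j _ => congrFun (dd_comm j k F) z]
  change oneSub w J F (z + Pi.single k 1) - oneSub w J F z = _
  rw [Finset.sum_congr rfl fun j _ => show dd k (dd j F) z =
    dd j F (z + Pi.single k 1) - dd j F z from rfl, Finset.sum_sub_distrib, oneSub, oneSub, dd]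
  ring

lemma oneSub_comm (w w' : ℝ) (J J' : Finset κ) (F : (κ → ℂ) → ℂ) :
    oneSub w J (oneSub w' J' F) = oneSub w' J' (oneSub w J F) := by
  ext z
  have h1 : ∀ k, dd k (oneSub w' J' F) z = dd k F z - w' * ∑ j ∈ J', dd j (dd k F) z :=
    fun k => by rw [dd_oneSub]; rfl
  have h2 : ∀ k, dd k (oneSub w J F) z = dd k F z - w * ∑ j ∈ J, dd j (dd k F) z :=
    fun k => by rw [dd_oneSub]; rfl
  change oneSub w' J' F z - w * ∑ k ∈ J, dd k (oneSub w' J' F) z =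
    oneSub w J F z - w' * ∑ k ∈ J', dd k (oneSub w J F) z
  simp only [h1, h2]
  simp only [oneSub, Finset.sum_sub_distrib, ← Finset.mul_sum]
  rw [Finset.sum_comm (s := J') (t := J)]
  rw [show ∑ y ∈ J, ∑ x ∈ J', dd y (dd x F) z = ∑ y ∈ J, ∑ x ∈ J', dd x (dd y F) z from
    Finset.sum_congr rfl fun j _ => Finset.sum_congr rfl fun i _ => by rw [dd_comm]]
  ring

lemma re_dd (k : κ) (F : (κ → ℂ) → ℂ) (x : κ → ℝ) :
    re (dd k F) x = re F (x + Pi.single k 1) - re F x := by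
  simp [re, dd, ofR_add_single]

lemma re_oneSub (w : ℝ) (J : Finset κ) (F : (κ → ℂ) → ℂ) (x : κ → ℝ) :
    re (oneSub w J F) x = re F x - w * ∑ k ∈ J, re (dd k F) x := by
  simp [re, oneSub]

namespace Stable

variable {F : (κ → ℂ) → ℂ}

lemma dd_affine (hF : Stable F) (l : κ) (z : κ → ℂ) (k : κ) (t : ℂ) :
    dd l F (z + Pi.single k t) = dd l F z + t * dd k (dd l F) z := by
  have h1 := hF.affine (z + Pi.single l 1) k t
  have h2 := hF.affine z k t
  rw [dd_comm]
  simp only [dd] at *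
  rw [add_right_comm, h1, h2]; ring

lemma dd_real (hF : Stable F) (k : κ) (x : κ → ℝ) : (dd k F (ofR x)).im = 0 := by
  have h := hF.real (x + Pi.single k 1)
  rw [ofR_add_single] at h
  simpa [dd, hF.real x] using h

lemma dd_cont (hF : Stable F) (k : κ) : Continuous (dd k F) :=
  (hF.cont.comp (by fun_prop)).sub hF.cont

lemma re_affine (hF : Stable F) (x : κ → ℝ) (k : κ) (t : ℝ) :
    re F (x + Pi.single k t) = re F x + t * re (dd k F) x := by
  rw [re, ofR_add_single, hF.affine]; simp [re]

lemma re_dd_affine (hF : Stable F) (x : κ → ℝ) (l k : κ) (t : ℝ) :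
    re (dd l F) (x + Pi.single k t) = re (dd l F) x + t * re (dd k (dd l F)) x := by
  rw [re, ofR_add_single, hF.dd_affine]; simp [re]

lemma im_dd_mul_conj_le (hF : Stable F) {z : κ → ℂ} (hz : ∀ k, 0 ≤ (z k).im) (k : κ) :
    (dd k F z * conj (F z)).im ≤ -(z k).im * Complex.normSq (dd k F z) := by
  have main : ∀ z : κ → ℂ, (∀ k, 0 < (z k).im) →
      (dd k F z * conj (F z)).im ≤ -(z k).im * Complex.normSq (dd k F z) := by
    intro z hz
    by_cases h0 : dd k F z = 0
    · simp [h0]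
    have hzero : F (z + Pi.single k (-F z / dd k F z)) = 0 := by
      rw [hF.affine, div_mul_cancel₀ _ h0]; ring
    have him : (z k + -F z / dd k F z).im ≤ 0 := by
      by_contra! hlt
      refine hF.ne_zero _ (fun j => ?_) hzero
      by_cases hj : j = k
      · subst hj; simpa using hlt
      · simpa [hj] using hz j
    have hN : 0 < Complex.normSq (dd k F z) := Complex.normSq_pos.2 h0
    rw [Complex.add_im, Complex.div_im] at him
    have : (z k).im * Complex.normSq (dd k F z) + ((-F z).im * (dd k F z).re
        - (-F z).re * (dd k F z).im) ≤ 0 := by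
      have := mul_nonpos_of_nonpos_of_nonneg him hN.le
      field_simp at this
      linarith
    simp only [Complex.mul_im, Complex.conj_re, Complex.conj_im, Complex.neg_im,
      Complex.neg_re] at *
    linarith
  have hcontz : Continuous fun η : ℝ =>
      (z + (fun _ => (η : ℂ) * Complex.I : κ → ℂ) : κ → ℂ) := by fun_prop
  have hc1 : Continuous fun η : ℝ => (dd k F ((z + (fun _ => (η : ℂ) * Complex.I : κ → ℂ) : κ → ℂ)) *
      conj (F ((z + (fun _ => (η : ℂ) * Complex.I : κ → ℂ) : κ → ℂ)))).im :=
    Complex.continuous_im.comp (((hF.dd_cont k).comp hcontz).mul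
      (Complex.continuous_conj.comp (hF.cont.comp hcontz)))
  have hc2 : Continuous fun η : ℝ => -(((z + (fun _ => (η : ℂ) * Complex.I : κ → ℂ) : κ → ℂ)) k).im *
      Complex.normSq (dd k F ((z + (fun _ => (η : ℂ) * Complex.I : κ → ℂ) : κ → ℂ))) :=
    (Complex.continuous_im.comp ((continuous_apply k).comp hcontz)).neg.mul
      (Complex.continuous_normSq.comp ((hF.dd_cont k).comp hcontz))
  have h1 := (hc1.tendsto 0).mono_left (nhdsWithin_le_nhds (s := Set.Ioi 0))
  have h2 := (hc2.tendsto 0).mono_left (nhdsWithin_le_nhds (s := Set.Ioi 0))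
  have hz0 : ((z + (fun _ => ((0 : ℝ) : ℂ) * Complex.I : κ → ℂ) : κ → ℂ)) = z := by ext; simp
  have := le_of_tendsto_of_tendsto h1 h2 (Filter.eventually_of_mem self_mem_nhdsWithin
    fun η hη => main _ fun j => by
      have : (0 : ℝ) < η := hη
      simpa using add_pos_of_nonneg_of_pos (hz j) this)
  rwa [hz0] at this

lemma dd_eq_zero (hF : Stable F) {z : κ → ℂ} (hz : ∀ k, 0 ≤ (z k).im) {k : κ}
    (hk : 0 < (z k).im) (h0 : F z = 0) : dd k F z = 0 := by
  have := hF.im_dd_mul_conj_le hz k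
  rw [h0, map_zero, mul_zero, Complex.zero_im] at this
  by_contra hne
  nlinarith [Complex.normSq_pos.2 hne]

/-- The vector `s` on the coordinates in `J`. -/
def shift {R : Type*} [Zero R] (J : Finset κ) (s : R) : κ → R := fun k => if k ∈ J then s else 0

lemma shift_insert {R : Type*} [AddMonoid R] {J : Finset κ} {k : κ} (hk : k ∉ J) (s : R) :
    shift (insert k J) s = shift J s + Pi.single k s := by
  ext j; by_cases h : j = k
  · subst h; simp [shift, hk]
  · simp [shift, h]

lemma ofR_add_shift (x : κ → ℝ) (J : Finset κ) (s : ℝ) :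
    ofR (x + shift J s) = ofR x + shift J (s : ℂ) := by
  ext j; simp only [ofR, shift, Pi.add_apply]; split_ifs <;> simp

lemma ne_zero_of_re_ne_zero (hF : Stable F) {x : κ → ℝ} (hx : F (ofR x) ≠ 0) (J : Finset κ)
    {s : ℂ} (hs : 0 < s.im) : F (ofR x + shift J s) ≠ 0 := by
  induction J using Finset.induction_on with
  | empty => simpa [shift, Pi.add_def] using hx
  | insert k J hk ih =>
    intro h0
    apply ih
    have hz : ∀ j, 0 ≤ ((ofR x + shift (insert k J) s) j).im := by
      intro j; simp only [ofR, shift, Pi.add_apply]; split_ifs <;> simp [hs.le]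
    have hd := hF.dd_eq_zero (k := k) hz (by simp [ofR, shift, hs]) h0
    have := hF.affine (ofR x + shift (insert k J) s) k (-s)
    rw [h0, hd, shift_insert hk, ← add_assoc, add_assoc, ← Pi.single_add] at this
    simpa using this

protected lemma oneSub (hF : Stable F) {w : ℝ} (hw : 0 < w) (J : Finset κ) :
    Stable (oneSub w J F) where
  affine z k t := by
    rw [dd_oneSub]
    simp only [StableFun.oneSub]
    rw [hF.affine, Finset.sum_congr rfl fun j _ => hF.dd_affine j z k t,
      Finset.sum_add_distrib, ← Finset.mul_sum,
      Finset.sum_congr rfl fun j _ => congrFun (dd_comm k j F) z]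
    ring
  real x := by
    simp [StableFun.oneSub, hF.real, hF.dd_real]
  cont := by
    unfold StableFun.oneSub
    have := hF.cont
    have := fun k => hF.dd_cont k
    fun_prop
  ne_zero z hz h0 := by
    have hFz := hF.ne_zero z hz
    rw [StableFun.oneSub, sub_eq_zero] at h0
    have h1 := congrArg (fun c => (c * conj (F z)).im) h0
    simp only [Complex.mul_conj, Complex.ofReal_im] at h1
    rw [mul_assoc, Finset.sum_mul, Complex.im_ofReal_mul, Complex.im_sum] at h1
    have h2 : ∀ k ∈ J, (dd k F z * conj (F z)).im ≤ 0 := fun k _ =>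
      (hF.im_dd_mul_conj_le (fun k => (hz k).le) k).trans
        (by nlinarith [hz k, Complex.normSq_nonneg (dd k F z)])
    have h3 := (Finset.sum_eq_zero_iff_of_nonpos h2).1
      ((mul_eq_zero.1 h1.symm).resolve_left hw.ne')
    have h4 : ∀ k ∈ J, dd k F z = 0 := fun k hk => by
      have := hF.im_dd_mul_conj_le (fun k => (hz k).le) k
      rw [h3 k hk] at this
      by_contra hne
      nlinarith [Complex.normSq_pos.2 hne, hz k, mul_pos (hz k) (Complex.normSq_pos.2 hne)]
    rw [Finset.sum_eq_zero h4, mul_zero] at h0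
    exact hFz h0

/-- The Rayleigh (negative dependence) inequality. -/
lemma rayleigh (hF : Stable F) (x : κ → ℝ) (j k : κ) :
    re (dd j (dd k F)) x * re F x ≤ re (dd j F) x * re (dd k F) x := by
  have h := hF.im_dd_mul_conj_le (z := ofR x + Pi.single j Complex.I) (fun l => by
    by_cases hl : l = j
    · subst hl; simp [ofR]
    · simp [ofR, hl]) k
  have h' : (dd k F (ofR x + Pi.single j Complex.I) *
      conj (F (ofR x + Pi.single j Complex.I))).im ≤ 0 := by
    refine h.trans ?_
    have : 0 ≤ ((ofR x + Pi.single j Complex.I : κ → ℂ) k).im := by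
      by_cases hl : k = j
      · subst hl; simp [ofR]
      · simp [ofR, hl]
    nlinarith [Complex.normSq_nonneg (dd k F (ofR x + Pi.single j Complex.I))]
  rw [hF.dd_affine, hF.affine] at h'
  have e1 : (dd j (dd k F) (ofR x)).im = 0 := by
    have h1 := hF.dd_real k (x + Pi.single j 1)
    rw [ofR_add_single] at h1
    rw [dd, Complex.sub_im, hF.dd_real k x]
    simpa using h1
  simp [hF.real, hF.dd_real, e1] at h'
  simp only [re]
  linarith

/-- Restriction of a stable function to a direction of equal coordinates is a polynomial. -/
lemma exists_polynomial (J : Finset κ) {G : (κ → ℂ) → ℂ}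
    (haff : ∀ z k t, G (z + Pi.single k t) = G z + t * dd k G z)
    (hreal : ∀ x : κ → ℝ, (G (ofR x)).im = 0) (x : κ → ℝ) :
    ∃ f : ℝ[X], (∀ s : ℂ, G (ofR x + shift J s) = aeval s f) ∧
      ∀ s : ℂ, ∑ k ∈ J, dd k G (ofR x + shift J s) = aeval s (derivative f) := by
  induction J using Finset.induction_on generalizing G with
  | empty =>
    refine ⟨C (re G x), fun s => ?_, fun s => by simp⟩
    have : ofR x + shift ∅ s = ofR x := by ext; simp [shift]
    rw [this, aeval_C]
    apply Complex.ext <;> simp [re, hreal]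
  | insert k J hk ih =>
    have haff' : ∀ z j t, dd k G (z + Pi.single j t) = dd k G z + t * dd j (dd k G) z := by
      intro z j t
      have h1 := haff (z + Pi.single k 1) j t
      have h2 := haff z j t
      rw [dd_comm]
      simp only [dd] at *
      rw [add_right_comm, h1, h2]; ring
    have hself : ∀ z, dd k (dd k G) z = 0 := fun z => by
      have h1 := haff z k 2
      have h2 := haff z k 1
      rw [dd, dd, add_assoc, ← Pi.single_add, one_add_one_eq_two, h1, h2]; ring
    obtain ⟨f₁, hf₁, hd₁⟩ := ih haff hreal
    obtain ⟨f₂, hf₂, hd₂⟩ := ih haff' fun y => by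
      have h := hreal (y + Pi.single k 1)
      rw [ofR_add_single] at h
      simpa [dd, hreal y] using h
    refine ⟨f₁ + X * f₂, fun s => ?_, fun s => ?_⟩
    · rw [shift_insert hk, ← add_assoc, haff, hf₁, hf₂]; simp
    · have hdd : ∀ j, dd j G (ofR x + shift J s + Pi.single k s) =
          dd j G (ofR x + shift J s) + s * dd j (dd k G) (ofR x + shift J s) := fun j => by
        have h1 := haff (ofR x + shift J s + Pi.single j 1) k s
        have h2 := haff (ofR x + shift J s) k s
        rw [dd, add_right_comm, h1, h2]
        simp only [dd]; ring
      rw [Finset.sum_insert hk, shift_insert hk, ← add_assoc]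
      simp only [hdd, Finset.sum_add_distrib, ← Finset.mul_sum, hd₁, hd₂, hself, hf₂]
      simp; ring

end Stable
end StableFun

namespace StableFun

variable {κ : Type*} {F : (κ → ℂ) → ℂ} {x : κ → ℝ}

/-- `F` is positive on the orthant above `x`. -/
def Above (F : (κ → ℂ) → ℂ) (x : κ → ℝ) : Prop := ∀ y : κ → ℝ, 0 ≤ y → 0 < re F (x + y)

lemma Above.pos (h : Above F x) : 0 < re F x := by simpa using h 0 le_rfl

lemma Above.mono (h : Above F x) {x' : κ → ℝ} (hx : x ≤ x') : Above F x' := fun y hy => by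
  have := h (x' - x + y) (add_nonneg (sub_nonneg.2 hx) hy)
  rwa [← add_assoc, add_sub_cancel] at this

lemma re_continuous (hF : Continuous F) : Continuous (re F) :=
  Complex.continuous_re.comp (hF.comp (continuous_pi fun k =>
    Complex.continuous_ofReal.comp (continuous_apply k)))

variable [DecidableEq κ]

lemma nonneg_induction [Fintype κ] {P : (κ → ℝ) → Prop} (h0 : P 0)
    (hstep : ∀ y j t, 0 ≤ y → 0 ≤ t → P y → P (y + Pi.single j t)) {y : κ → ℝ} (hy : 0 ≤ y) :
    P y := by
  have h : ∀ S : Finset κ, P (fun k => if k ∈ S then y k else 0) := by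
    intro S
    induction S using Finset.induction_on with
    | empty => exact h0
    | insert k S hk ih =>
      have e : (fun j => if j ∈ insert k S then y j else 0) =
          (fun j => if j ∈ S then y j else 0) + Pi.single k (y k) := by
        ext j; by_cases hj : j = k
        · subst hj; simp [hk]
        · simp [hj]
      rw [e]
      refine hstep _ _ _ (fun j => ?_) (hy k) ih
      dsimp only [Pi.zero_apply]; split_ifs
      · exact hy j
      · exact le_rfl
  simpa using h Finset.univ

namespace Above

lemma dd_nonneg (h : Above F x) (hF : Stable F) (k : κ) : 0 ≤ re (dd k F) x := by
  by_contra! hlt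
  have h1 := h (Pi.single k (-re F x / re (dd k F) x))
    (Pi.single_nonneg.2 (div_nonneg_of_nonpos (neg_nonpos.2 h.pos.le) hlt.le))
  rw [hF.re_affine, div_mul_cancel₀ _ hlt.ne] at h1
  linarith

lemma dd_mul_le [Fintype κ] (h : Above F x) (hF : Stable F) (k : κ) {y : κ → ℝ} (hy : 0 ≤ y) :
    re (dd k F) (x + y) * re F x ≤ re (dd k F) x * re F (x + y) := by
  refine nonneg_induction (P := fun y => re (dd k F) (x + y) * re F x ≤
    re (dd k F) x * re F (x + y)) (by simp) (fun y j t hy ht ih => ?_) hy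
  have hp := h y hy
  have hray := hF.rayleigh (x + y) j k
  have hj : 0 < re F (x + (y + Pi.single j t)) :=
    h _ (add_nonneg hy (Pi.single_nonneg.2 ht))
  have h1 : re (dd k F) (x + (y + Pi.single j t)) * re F (x + y) ≤
      re (dd k F) (x + y) * re F (x + (y + Pi.single j t)) := by
    rw [← add_assoc, hF.re_affine, hF.re_dd_affine]
    nlinarith [mul_le_mul_of_nonneg_left hray ht]
  refine le_of_mul_le_mul_right ?_ hp
  nlinarith [mul_le_mul_of_nonneg_right h1 h.pos.le, mul_le_mul_of_nonneg_right ih hj.le]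

lemma barrier [Fintype κ] (h : Above F x) (hF : Stable F) {J : Finset κ} {w a : ℝ} (hw : 0 < w)
    (hΦ : w * ∑ j ∈ J, re (dd j F) x ≤ (1 - w / a) * re F x) {y : κ → ℝ}
    (hy : 0 ≤ y) :
    w * ∑ j ∈ J, re (dd j F) (x + y) ≤ (1 - w / a) * re F (x + y) := by
  refine le_of_mul_le_mul_right ?_ h.pos
  have h1 : (∑ j ∈ J, re (dd j F) (x + y)) * re F x ≤
      (∑ j ∈ J, re (dd j F) x) * re F (x + y) := by
    rw [Finset.sum_mul, Finset.sum_mul]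
    exact Finset.sum_le_sum fun j _ => h.dd_mul_le hF j hy
  nlinarith [mul_le_mul_of_nonneg_left h1 hw.le, mul_le_mul_of_nonneg_right hΦ (h y hy).le]

lemma shift_nonneg {J : Finset κ} {a : ℝ} (ha : 0 ≤ a) : 0 ≤ Stable.shift J a := fun j => by
  simp only [Stable.shift, Pi.zero_apply]; split_ifs <;> simp [ha]

/-- The barrier step keeps the orthant free of zeros. -/
lemma oneSub_shift [Fintype κ] (h : Above F x) (hF : Stable F) {J : Finset κ} {w a : ℝ}
    (hw : 0 < w) (ha : 0 < a)
    (hΦ : w * ∑ j ∈ J, re (dd j F) x ≤ (1 - w / a) * re F x) :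
    Above (oneSub w J F) (x + Stable.shift J a) := by
  intro y hy
  have hy' := add_nonneg (shift_nonneg (J := J) ha.le) hy
  have h1 := h.barrier hF hw hΦ hy'
  have h2 := h _ hy'
  rw [re_oneSub, add_assoc]
  have : 0 < w / a * re F (x + (Stable.shift J a + y)) := by positivity
  linarith

lemma eval_eq {G : (κ → ℂ) → ℂ} {J : Finset κ} {f : ℝ[X]}
    (hf : ∀ s : ℂ, G (ofR x + Stable.shift J s) = aeval s f) (s : ℝ) :
    f.eval s = re G (x + Stable.shift J s) := by
  rw [re, Stable.ofR_add_shift, hf, ← Complex.coe_algebraMap, aeval_algebraMap_apply,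
    coe_aeval_eq_eval]
  simp

/-- The barrier step does not increase the potentials. -/
lemma dd_oneSub_shift_le [Fintype κ] (h : Above F x) (hF : Stable F) {J : Finset κ} {w a : ℝ}
    (hw : 0 < w) (ha : 0 < a)
    (hΦ : w * ∑ j ∈ J, re (dd j F) x ≤ (1 - w / a) * re F x) (k : κ) :
    re (dd k (oneSub w J F)) (x + Stable.shift J a) * re F x ≤
      re (dd k F) x * re (oneSub w J F) (x + Stable.shift J a) := by
  obtain ⟨f, hf, hf'⟩ := Stable.exists_polynomial J hF.affine hF.real x
  obtain ⟨g, hg, hg'⟩ := Stable.exists_polynomial J (hF.dd_affine k) (hF.dd_real k) x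
  have hfpos : ∀ s, 0 ≤ s → 0 < f.eval s := fun s hs => by
    rw [eval_eq hf]; exact h _ (shift_nonneg hs)
  have hx0 : x + Stable.shift J 0 = x := by ext; simp [Stable.shift]
  have key := convexDefect_nonneg ha (f := f) (g := g)
    (fun s hs => by
      rw [← hf]
      refine hF.ne_zero_of_re_ne_zero (fun h0 => h.pos.ne' ?_) J hs
      rw [re, h0, Complex.zero_re])
    hfpos
    (degree_le_of_bounded (M := re (dd k F) x / re F x) hfpos
      (fun s hs => by
        rw [eval_eq hg]; exact (h.mono (by simpa using shift_nonneg hs)).dd_nonneg hF k)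
      (fun s hs => by
        rw [eval_eq hg, eval_eq hf, div_mul_eq_mul_div, le_div_iff₀ h.pos]
        exact h.dd_mul_le hF k (shift_nonneg hs)))
    (fun s hs => by
      have him : ∀ j, 0 ≤ ((ofR x + Stable.shift J s) j).im := fun j => by
        simp only [ofR, Stable.shift, Pi.add_apply]; split_ifs <;> simp [hs.le]
      rw [← hf, ← hg]
      exact (hF.im_dd_mul_conj_le him k).trans
        (mul_nonpos_of_nonpos_of_nonneg (neg_nonpos.2 (him k)) (Complex.normSq_nonneg _)))
  set z := x + Stable.shift J a with hz
  have e1 : f.derivative.eval a = ∑ j ∈ J, re (dd j F) z := by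
    have := eval_eq (G := fun z => ∑ j ∈ J, dd j F z) (x := x) (J := J) hf' a
    rw [this]; simp [re, hz]
  have e2 : g.derivative.eval a = ∑ j ∈ J, re (dd j (dd k F)) z := by
    have := eval_eq (G := fun z => ∑ j ∈ J, dd j (dd k F) z) (x := x) (J := J) hg' a
    rw [this]; simp [re, hz]
  have hray : g.derivative.eval a * f.eval a ≤ f.derivative.eval a * g.eval a := by
    rw [e1, e2, eval_eq hf, eval_eq hg, Finset.sum_mul, Finset.sum_mul]
    exact Finset.sum_le_sum fun j _ => hF.rayleigh z j k
  have hb := h.barrier hF hw hΦ (shift_nonneg (J := J) ha.le)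
  rw [dd_oneSub, re_oneSub, re_oneSub, ← e1, ← e2]
  rw [← hz, ← e1] at hb
  rw [convexDefect] at key
  have q0 := eval_eq hf 0
  have q1 := eval_eq hg 0
  have q2 := eval_eq hf a
  have q3 := eval_eq hg a
  rw [hx0] at q0 q1
  rw [← hz] at q2 q3
  rw [← q2] at hb
  rw [← q0, ← q1, ← q2, ← q3]
  have hf0 := hfpos 0 le_rfl
  have hfa := hfpos a ha.le
  generalize eval 0 f = f0 at *
  generalize eval 0 g = g0 at *
  generalize eval a f = fa at *
  generalize eval a g = ga at *
  generalize eval a (derivative f) = f' at *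
  generalize eval a (derivative g) = g' at *
  have hb' : w * fa ≤ a * (fa - w * f') := by
    have := mul_le_mul_of_nonneg_left hb ha.le
    have e : a * ((1 - w / a) * fa) = a * fa - w * fa := by field_simp
    linarith
  have hpos : 0 ≤ fa - w * f' := by
    have : 0 ≤ a * (fa - w * f') := le_trans (by positivity) hb'
    exact nonneg_of_mul_nonneg_right this ha
  have hD : 0 ≤ f' * ga - g' * fa := by linarith
  refine le_of_mul_le_mul_right ?_ (pow_pos hfa 2)
  have t1 := mul_nonneg key hpos
  have t2 := mul_nonneg hf0.le (mul_nonneg hD (sub_nonneg.2 hb'))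
  nlinarith

end Above

/-- The operators `1 - w ∑ ∂ₖ` preserve positivity far away. -/
lemma Above.exists_oneSub (h : Above F x) (hF : Stable F) {w : ℝ} (hw : 0 < w) (J : Finset κ) :
    ∃ x', Above (oneSub w J F) x' := by
  set s := w * J.card + 1 with hs
  have hs0 : 0 < s := by positivity
  refine ⟨x + fun _ => s, fun y hy => ?_⟩
  set z := x + (fun _ => s) + y with hz
  have h1 : ∀ k, s * re (dd k F) z ≤ re F z := fun k => by
    have := h ((fun _ => s) + y + Pi.single k (-s)) (fun j => by
      by_cases hj : j = k
      · subst hj; simpa using hy j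
      · simpa [hj] using add_nonneg hs0.le (hy j))
    rw [← add_assoc, ← add_assoc, ← hz, hF.re_affine] at this
    linarith
  have hpos : 0 < re F z := by
    rw [hz, add_assoc]; exact h _ (add_nonneg (fun _ => hs0.le) hy)
  rw [re_oneSub]
  have h2 : s * ∑ k ∈ J, re (dd k F) z ≤ J.card * re F z := by
    rw [Finset.mul_sum, ← nsmul_eq_mul]
    exact Finset.sum_le_card_nsmul _ _ _ fun k _ => h1 k
  refine pos_of_mul_pos_right (a := s) ?_ hs0.le
  have h3 := mul_le_mul_of_nonneg_left h2 hw.le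
  nlinarith

lemma Above.exists_sub [Fintype κ] (h : Above F x) (hF : Stable F) :
    ∃ η > 0, Above F (x - fun _ => η) := by
  have main : ∀ S : Finset κ, ∃ η > 0, Above F (x - Stable.shift S η) := by
    intro S
    induction S using Finset.induction_on with
    | empty => exact ⟨1, one_pos, h.mono (by intro j; simp [Stable.shift])⟩
    | insert k S hk ih =>
      obtain ⟨η₀, hη₀, h₀⟩ := ih
      set x' := x - Stable.shift S η₀
      have hd := h₀.dd_nonneg hF k
      set η₁ := re F x' / (re (dd k F) x' + 1)
      have hη₁ : 0 < η₁ := div_pos h₀.pos (by linarith)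
      have hlt : η₁ * re (dd k F) x' < re F x' := by
        rw [div_mul_eq_mul_div, div_lt_iff₀ (by linarith)]
        nlinarith [h₀.pos]
      have h₁ : Above F (x' + Pi.single k (-η₁)) := by
        intro y hy
        rw [add_right_comm, hF.re_affine]
        have h1 := h₀.dd_mul_le hF k hy
        refine pos_of_mul_pos_left (b := re F x') ?_ h₀.pos.le
        nlinarith [mul_lt_mul_of_pos_right hlt (h₀ y hy), mul_le_mul_of_nonneg_left h1 hη₁.le]
      refine ⟨min η₀ η₁, lt_min hη₀ hη₁, h₁.mono fun j => ?_⟩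
      by_cases hj : j = k
      · subst hj; simp [x', Stable.shift, hk]; grind
      · simp only [x', Stable.shift, Pi.add_apply, Pi.sub_apply, Finset.mem_insert, hj, false_or,
          Pi.single_eq_of_ne hj]
        have := min_le_left η₀ η₁
        split_ifs <;> simp; linarith
  obtain ⟨η, hη, h'⟩ := main Finset.univ
  exact ⟨η, hη, h'.mono fun j => by simp [Stable.shift]⟩

/-- Removing an operator `1 - w ∑ ∂ₖ` keeps the orthant free of zeros. -/
lemma Above.of_oneSub [Fintype κ] (hF : Stable F) (hev : ∃ x₀, Above F x₀) {w : ℝ} (hw : 0 < w) {J : Finset κ}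
    (h : Above (oneSub w J F) x) : Above F x := by
  set T := {s : ℝ | 0 ≤ s ∧ Above F (x + fun _ => s)} with hT
  have hne : T.Nonempty := by
    obtain ⟨x₀, h₀⟩ := hev
    refine ⟨∑ k, |x₀ k - x k|, Finset.sum_nonneg fun _ _ => abs_nonneg _, h₀.mono fun k => ?_⟩
    have := Finset.single_le_sum (f := fun k => |x₀ k - x k|) (fun _ _ => abs_nonneg _)
      (Finset.mem_univ k)
    have h2 := le_abs_self (x₀ k - x k)
    simp only [Pi.add_apply]
    linarith
  have hbdd : BddBelow T := ⟨0, fun s hs => hs.1⟩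
  have hs0 : 0 ≤ sInf T := le_csInf hne fun s hs => hs.1
  have hgt : ∀ s, sInf T < s → Above F (x + fun _ => s) := fun s hs => by
    obtain ⟨t, ht, hts⟩ := (csInf_lt_iff hbdd hne).1 hs
    exact ht.2.mono fun k => by simpa using hts.le
  have hlim : ∀ G : (κ → ℂ) → ℂ, Continuous G → ∀ y : κ → ℝ,
      (∀ s, sInf T < s → 0 ≤ re G (x + (fun _ => s) + y)) →
      0 ≤ re G (x + (fun _ => sInf T) + y) := by
    intro G hG y hs
    have hc : Continuous fun s : ℝ => re G (x + (fun _ => s : κ → ℝ) + y) :=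
      (re_continuous hG).comp (by fun_prop)
    exact ge_of_tendsto ((hc.tendsto (sInf T)).mono_left nhdsWithin_le_nhds)
      (Filter.eventually_of_mem self_mem_nhdsWithin fun s hs' => hs s hs' :
        ∀ᶠ s in nhdsWithin (sInf T) (Set.Ioi (sInf T)), _)
  have hmem : Above F (x + fun _ => sInf T) := by
    intro y hy
    have h1 := h ((fun _ => sInf T) + y) (add_nonneg (fun _ => hs0) hy)
    rw [re_oneSub, ← add_assoc] at h1
    have h2 : ∀ k ∈ J, 0 ≤ re (dd k F) (x + (fun _ => sInf T) + y) := fun k _ =>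
      hlim _ (hF.dd_cont k) y fun s hs =>
        ((hgt s hs).mono (by simpa using hy)).dd_nonneg hF k
    have := mul_nonneg hw.le (Finset.sum_nonneg h2)
    linarith
  rcases hs0.eq_or_lt with h0 | h0
  · exact hmem.mono fun k => by simp [← h0]
  · obtain ⟨η, hη, hη'⟩ := hmem.exists_sub hF
    have : max 0 (sInf T - η) ∈ T := ⟨le_max_left _ _, hη'.mono fun k => by
      simp only [Pi.add_apply, Pi.sub_apply]
      linarith [le_max_right 0 (sInf T - η)]⟩
    have h3 := csInf_le hbdd this
    rcases le_max_iff.1 h3 with h4 | h4 <;> linarith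

lemma Above.exists_singleton [Fintype κ] (hF : Stable F) (hev : ∃ x₀, Above F x₀) {w : ℝ} (hw : 0 < w)
    {J : Finset κ} (hJ : J.Nonempty) (h : Above (oneSub w J F) x) :
    ∃ j ∈ J, Above (oneSub (J.card * w) {j} F) x := by
  have hA := Above.of_oneSub hF hev hw h
  have h0 := h.pos
  rw [re_oneSub] at h0
  obtain ⟨j, hj, hlt⟩ : ∃ j ∈ J, J.card * w * re (dd j F) x < re F x := by
    refine Finset.exists_lt_of_sum_lt (s := J) ?_
    rw [← Finset.mul_sum, Finset.sum_const, nsmul_eq_mul, mul_assoc]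
    exact mul_lt_mul_of_pos_left (by linarith) (by exact_mod_cast hJ.card_pos)
  refine ⟨j, hj, fun y hy => ?_⟩
  rw [re_oneSub, Finset.sum_singleton]
  have h1 := hA.dd_mul_le hF j hy
  have hc : (0 : ℝ) ≤ J.card * w := by positivity
  refine pos_of_mul_pos_left (b := re F x) ?_ hA.pos.le
  nlinarith [mul_lt_mul_of_pos_right hlt (hA y hy), mul_le_mul_of_nonneg_left h1 hc]

variable {ι : Type*} {w a : ℝ} (J : ι → Finset κ)

/-- Successive application of the operators `1 - w ∑ k ∈ J i, ∂ₖ`. -/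
noncomputable def oneSubs (w : ℝ) (J : ι → Finset κ) (l : List ι) (F : (κ → ℂ) → ℂ) :
    (κ → ℂ) → ℂ := l.foldr (fun i G => oneSub w (J i) G) F

lemma oneSubs_cons (i : ι) (l : List ι) (F : (κ → ℂ) → ℂ) :
    oneSubs w J (i :: l) F = oneSub w (J i) (oneSubs w J l F) := rfl

lemma oneSubs_oneSub (w' : ℝ) (J' : Finset κ) (l : List ι) (F : (κ → ℂ) → ℂ) :
    oneSubs w J l (oneSub w' J' F) = oneSub w' J' (oneSubs w J l F) := by
  induction l with
  | nil => rfl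
  | cons i l ih => rw [oneSubs_cons, ih, oneSub_comm, ← oneSubs_cons]

lemma Stable.oneSubs (hF : Stable F) (hw : 0 < w) (l : List ι) :
    Stable (oneSubs w J l F) := by
  induction l with
  | nil => exact hF
  | cons i l ih => exact ih.oneSub hw (J i)

lemma Above.exists_oneSubs (h : ∃ x, Above F x) (hF : Stable F) (hw : 0 < w) (l : List ι) :
    ∃ x, Above (oneSubs w J l F) x := by
  induction l with
  | nil => exact h
  | cons i l ih => obtain ⟨x, hx⟩ := ih; exact hx.exists_oneSub (hF.oneSubs J hw l) hw (J i)

lemma Above.exists_choice [Fintype κ] {r : ℕ} (hr : 0 < r) (hJ : ∀ i, (J i).card = r) (hw : 0 < w) {l : List ι}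
    (hl : l.Nodup) (hF : Stable F) (hev : ∃ x₀, Above F x₀) (h : Above (oneSubs w J l F) x) :
    ∃ col : ι → κ, (∀ i ∈ l, col i ∈ J i) ∧ Above (oneSubs (r * w) (fun i => {col i}) l F) x := by
  classical
  induction l generalizing F with
  | nil =>
    by_cases hι : Nonempty ι
    · have : ∀ i, ∃ j, j ∈ J i := fun i => Finset.card_pos.1 (by rw [hJ]; exact hr)
      choose col hcol using this
      exact ⟨col, fun i _ => hcol i, h⟩
    · exact ⟨fun i => (hι ⟨i⟩).elim, by simp, h⟩
  | cons i l ih =>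
    rw [List.nodup_cons] at hl
    rw [oneSubs_cons] at h
    obtain ⟨j, hj, h1⟩ := Above.exists_singleton (hF.oneSubs J hw l)
      (Above.exists_oneSubs J hev hF hw l) hw
      (Finset.card_pos.1 (by rw [hJ]; exact hr)) h
    have hrw : (0 : ℝ) < r * w := by positivity
    rw [hJ, ← oneSubs_oneSub] at h1
    obtain ⟨x₀, hx₀⟩ := hev
    obtain ⟨col, hcol, h2⟩ := ih hl.2 (hF.oneSub hrw {j}) (hx₀.exists_oneSub hF hrw {j}) h1
    have hcongr : ∀ l' : List ι, i ∉ l' →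
        oneSubs (r * w) (fun i' => {Function.update col i j i'}) l' F =
          oneSubs (r * w) (fun i' => {col i'}) l' F := by
      intro l' hi
      induction l' with
      | nil => rfl
      | cons i' l' ih =>
        rw [List.mem_cons, not_or] at hi
        rw [oneSubs_cons, oneSubs_cons, ih hi.2, Function.update_of_ne (Ne.symm hi.1)]
    refine ⟨Function.update col i j, ?_, ?_⟩
    · intro i' hi'
      rcases List.mem_cons.1 hi' with rfl | hmem
      · simpa using hj
      · rw [Function.update_of_ne (by rintro rfl; exact hl.1 hmem)]; exact hcol i' hmem
    · rw [oneSubs_cons, hcongr l hl.1, Function.update_self]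
      rwa [oneSubs_oneSub] at h2

lemma oneSubs_singleton (hF : Stable F) (c : ℝ) (col : ι → κ) (l : List ι) (z : κ → ℂ) :
    oneSubs c (fun i => {col i}) l F z =
      F (z - (l.map fun i => (Pi.single (col i) (c : ℂ) : κ → ℂ)).sum) := by
  induction l generalizing z with
  | nil => simp [oneSubs]
  | cons i l ih =>
    have h := hF.affine (z - (l.map fun i => (Pi.single (col i) (c : ℂ) : κ → ℂ)).sum) (col i) (-c)
    rw [oneSubs_cons, oneSub, Finset.sum_singleton, dd, ih, ih, List.map_cons, List.sum_cons,
      add_comm (Pi.single _ _), sub_add_eq_sub_sub, sub_eq_add_neg _ (Pi.single _ _),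
      ← Pi.single_neg, h, dd, add_sub_right_comm]
    ring

/-- The barrier argument. -/
lemma Above.oneSubs [Fintype κ] (h : Above F x) (hF : Stable F) (hw : 0 < w) (ha : 0 < a)
    (hΦ : ∀ i, w * ∑ j ∈ J i, re (dd j F) x ≤ (1 - w / a) * re F x) (l : List ι) :
    Above (oneSubs w J l F) (x + (l.map fun i => Stable.shift (J i) a).sum) := by
  suffices Above (StableFun.oneSubs w J l F) (x + (l.map fun i => Stable.shift (J i) a).sum) ∧
      ∀ k, re (dd k (StableFun.oneSubs w J l F)) (x + (l.map fun i => Stable.shift (J i) a).sum) *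
        re F x ≤ re (dd k F) x *
          re (StableFun.oneSubs w J l F) (x + (l.map fun i => Stable.shift (J i) a).sum) from this.1
  induction l with
  | nil => simpa [StableFun.oneSubs] using h
  | cons i l ih =>
    obtain ⟨ih1, ih2⟩ := ih
    have hS := hF.oneSubs J hw l
    set G := StableFun.oneSubs w J l F
    set X := x + (l.map fun i => Stable.shift (J i) a).sum
    have e : x + ((i :: l).map fun i => Stable.shift (J i) a).sum = X + Stable.shift (J i) a := by
      rw [List.map_cons, List.sum_cons, add_comm (Stable.shift (J i) a), ← add_assoc]
    have hG : w * ∑ j ∈ J i, re (dd j G) X ≤ (1 - w / a) * re G X := by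
      refine le_of_mul_le_mul_right ?_ h.pos
      have h1 : (∑ j ∈ J i, re (dd j G) X) * re F x ≤ (∑ j ∈ J i, re (dd j F) x) * re G X := by
        rw [Finset.sum_mul, Finset.sum_mul]
        exact Finset.sum_le_sum fun j _ => ih2 j
      nlinarith [mul_le_mul_of_nonneg_left h1 hw.le,
        mul_le_mul_of_nonneg_right (hΦ i) ih1.pos.le]
    rw [e, oneSubs_cons]
    have hA := ih1.oneSub_shift hS hw ha hG
    refine ⟨hA, fun k => ?_⟩
    have h1 := ih1.dd_oneSub_shift_le hS hw ha hG k
    refine le_of_mul_le_mul_right ?_ ih1.pos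
    nlinarith [mul_le_mul_of_nonneg_right h1 h.pos.le,
      mul_le_mul_of_nonneg_right (ih2 k) hA.pos.le]

end StableFun

section Paving

variable {ι : Type*} [Fintype ι]

/-- The quadratic form of a matrix. -/
def quadForm (M : Matrix ι ι ℂ) (v : ι → ℂ) : ℝ := (star v ⬝ᵥ M *ᵥ v).re

lemma quadForm_sub (M N : Matrix ι ι ℂ) (v : ι → ℂ) :
    quadForm (M - N) v = quadForm M v - quadForm N v := by
  simp [quadForm, sub_mulVec]

lemma Matrix.IsHermitian.dotProduct_mulVec_eq_quadForm {M : Matrix ι ι ℂ} (hM : M.IsHermitian)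
    (v : ι → ℂ) : star v ⬝ᵥ M *ᵥ v = quadForm M v := by
  apply Complex.ext
  · simp [quadForm]
  · simpa using hM.im_star_dotProduct_mulVec_self v

lemma Matrix.IsHermitian.posSemidef_of_quadForm {M : Matrix ι ι ℂ} (hM : M.IsHermitian)
    (h : ∀ v, 0 ≤ quadForm M v) : M.PosSemidef :=
  .of_dotProduct_mulVec_nonneg hM fun v => by
    rw [hM.dotProduct_mulVec_eq_quadForm]; exact_mod_cast h v

lemma Matrix.IsHermitian.posDef_of_quadForm {M : Matrix ι ι ℂ} (hM : M.IsHermitian)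
    (h : ∀ v, v ≠ 0 → 0 < quadForm M v) : M.PosDef :=
  .of_dotProduct_mulVec_pos hM fun v hv => by
    rw [hM.dotProduct_mulVec_eq_quadForm]; exact_mod_cast h v hv

lemma Matrix.PosSemidef.quadForm_nonneg {M : Matrix ι ι ℂ} (hM : M.PosSemidef) (v : ι → ℂ) :
    0 ≤ quadForm M v := (Complex.nonneg_iff.1 (hM.dotProduct_mulVec_nonneg v)).1

lemma Matrix.IsHermitian.star_dotProduct_mulVec {M : Matrix ι ι ℂ} (hM : M.IsHermitian)
    (u v : ι → ℂ) : star (star u ⬝ᵥ M *ᵥ v) = star v ⬝ᵥ M *ᵥ u := by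
  rw [← star_dotProduct_star, star_star, star_mulVec, hM.eq, ← dotProduct_mulVec]

lemma Matrix.IsHermitian.quadForm_sub_smul {M : Matrix ι ι ℂ} (hM : M.IsHermitian) (s : ℂ)
    (u v : ι → ℂ) : quadForm M (u - s • v) =
      quadForm M u - 2 * (star s * (star v ⬝ᵥ M *ᵥ u)).re + Complex.normSq s * quadForm M v := by
  have e : star (u - s • v) ⬝ᵥ M *ᵥ (u - s • v) = star u ⬝ᵥ M *ᵥ u
      - star (star s * (star v ⬝ᵥ M *ᵥ u)) - star s * (star v ⬝ᵥ M *ᵥ u)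
      + Complex.normSq s * (star v ⬝ᵥ M *ᵥ v) := by
    rw [star_mul', star_star, hM.star_dotProduct_mulVec, Complex.normSq_eq_conj_mul_self]
    simp only [star_sub, star_smul, mulVec_sub, mulVec_smul, sub_dotProduct, dotProduct_sub,
      smul_dotProduct, dotProduct_smul, smul_eq_mul, Complex.star_def]
    ring
  rw [quadForm, e, hM.dotProduct_mulVec_eq_quadForm, hM.dotProduct_mulVec_eq_quadForm]
  simp [← Complex.ofReal_mul]
  ring

variable [DecidableEq ι]

lemma quadForm_one (v : ι → ℂ) : quadForm 1 v = ∑ i, Complex.normSq (v i) := by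
  simp [quadForm, dotProduct, Complex.normSq_apply]

lemma quadForm_diagonal (d : ι → ℝ) (v : ι → ℂ) :
    quadForm (diagonal fun i => (d i : ℂ)) v = ∑ i, d i * Complex.normSq (v i) := by
  simp only [quadForm, dotProduct, mulVec_diagonal, Complex.normSq_apply, Complex.re_sum]
  refine Finset.sum_congr rfl fun i _ => ?_
  simp; ring

lemma isHermitian_diagonal_ofReal {κ : Type*} [DecidableEq κ] (d : κ → ℝ) :
    (diagonal fun i => (d i : ℂ)).IsHermitian :=
  isHermitian_diagonal_of_self_adjoint _ (by ext; simp)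

lemma det_add_diagonal_single (M : Matrix ι ι ℂ) (i : ι) (t : ℂ) :
    (M + diagonal (Pi.single i t)).det = M.det + t * (M.updateRow i (Pi.single i 1)).det := by
  have : M + diagonal (Pi.single i t) = M.updateRow i (M i + t • Pi.single i 1) := by
    ext k l
    by_cases hk : k = i
    · subst hk
      by_cases hl : l = k
      · subst hl; simp
      · simp [hl, diagonal_apply_ne _ (Ne.symm hl)]
    · by_cases hl : k = l
      · subst hl; simp [hk]
      · simp [hk, diagonal_apply_ne _ hl]
  rw [this, det_updateRow_add, det_updateRow_smul, updateRow_eq_self]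

variable {r : ℕ}

/-- The product over `j` of the determinants of `N` plus the diagonal matrix of the `z (i, j)`. -/
noncomputable def blockDet (r : ℕ) (N : Matrix ι ι ℂ) (z : ι × Fin r → ℂ) : ℂ :=
  ∏ j, (diagonal (fun i => z (i, j)) + N).det

open StableFun

lemma blockDet_stable {N : Matrix ι ι ℂ} (hN : N.IsHermitian) : Stable (blockDet r N) where
  affine z k t := by
    obtain ⟨i, j⟩ := k
    have h : ∃ c d : ℂ, ∀ t, blockDet r N (z + Pi.single (i, j) t) = c + t * d := by
      have e1 : ∀ t, (diagonal (fun i' => (z + Pi.single (i, j) t : ι × Fin r → ℂ) (i', j)) + N).det =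
          (diagonal (fun i' => z (i', j)) + N).det +
            t * ((diagonal (fun i' => z (i', j)) + N).updateRow i (Pi.single i 1)).det := by
        intro t
        rw [← det_add_diagonal_single, add_right_comm, diagonal_add]
        congr 4
        ext i'
        by_cases h : i' = i
        · subst h; simp
        · simp [h]
      have e2 : ∀ t, ∀ j' ∈ ({j}ᶜ : Finset (Fin r)),
          (diagonal (fun i' => (z + Pi.single (i, j) t : ι × Fin r → ℂ) (i', j')) + N).det =
          (diagonal (fun i' => z (i', j')) + N).det := by
        intro t j' hj'
        rw [Finset.mem_compl, Finset.mem_singleton] at hj'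
        simp [hj']
      set R := ∏ j' ∈ {j}ᶜ, (diagonal (fun i' => z (i', j')) + N).det
      refine ⟨(diagonal (fun i' => z (i', j)) + N).det * R,
        ((diagonal (fun i' => z (i', j)) + N).updateRow i (Pi.single i 1)).det * R, fun t => ?_⟩
      rw [blockDet, Fintype.prod_eq_mul_prod_compl j, e1, Finset.prod_congr rfl (e2 t), add_mul,
        mul_assoc]
    obtain ⟨c, d, h⟩ := h
    have h0 := h 0
    have h1 := h 1
    rw [Pi.single_zero, add_zero] at h0
    rw [dd, h, h0, h1]; ring
  real x := by
    have h : ∀ j, star (diagonal (fun i => ofR x (i, j)) + N).det =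
        (diagonal (fun i => ofR x (i, j)) + N).det := fun j => by
      rw [← det_conjTranspose]
      exact congrArg det ((isHermitian_diagonal_ofReal fun i => x (i, j)).add hN).eq
    rw [← Complex.conj_eq_iff_im, blockDet, map_prod]
    exact Finset.prod_congr rfl fun j _ => h j
  cont := by
    unfold blockDet
    refine continuous_finsetProd _ fun j _ => Continuous.matrix_det ?_
    exact (Continuous.matrix_diagonal (by fun_prop)).add continuous_const
  ne_zero z hz := by
    refine Finset.prod_ne_zero_iff.2 fun j _ h0 => ?_
    obtain ⟨v, hv, hv0⟩ := exists_mulVec_eq_zero_iff.2 h0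
    have h1 := congrArg (fun u => (star v ⬝ᵥ u).im) hv0
    simp only [add_mulVec, dotProduct_add, Complex.add_im, dotProduct_zero, Complex.zero_im,
      hN.dotProduct_mulVec_eq_quadForm, Complex.ofReal_im, add_zero] at h1
    simp only [dotProduct, mulVec_diagonal, Complex.im_sum] at h1
    have h2 : ∀ i, (star v i * (z (i, j) * v i)).im = (z (i, j)).im * Complex.normSq (v i) := by
      intro i; simp [Complex.normSq_apply]; ring
    simp only [h2] at h1
    rw [Finset.sum_eq_zero_iff_of_nonneg
      fun i _ => mul_nonneg (hz _).le (Complex.normSq_nonneg _)] at h1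
    refine hv (funext fun i => ?_)
    simpa [(hz (i, j)).ne'] using h1 i (Finset.mem_univ i)

lemma Matrix.IsHermitian.posSemidef_of_det_ne_zero {M : Matrix ι ι ℂ} (hM : M.IsHermitian)
    (h : ∀ t : ℝ, 0 ≤ t → (diagonal (fun _ => (t : ℂ)) + M).det ≠ 0) : M.PosSemidef := by
  rw [hM.posSemidef_iff_eigenvalues_nonneg]
  intro i
  by_contra! hlt
  refine h (-hM.eigenvalues i) (by simpa using hlt.le) (exists_mulVec_eq_zero_iff.1
    ⟨hM.eigenvectorBasis i, fun h0 => ?_, ?_⟩)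
  · exact hM.eigenvectorBasis.orthonormal.ne_zero i (by ext j; exact congrFun h0 j)
  · rw [add_mulVec, hM.mulVec_eigenvectorBasis]
    ext j
    simp

lemma exists_color_sub_diagonal_posSemidef {N : Matrix ι ι ℂ} (hN : N.IsHermitian) {a δ w : ℝ}
    (ha : 0 < a) (hδ : 0 < δ) (hw : 0 < w) (hr : 0 < r)
    (h1 : (N - diagonal fun _ => (a : ℂ)).PosDef)
    (h2 : ∀ i, (N - (diagonal fun k => ((a + if k = i then δ else 0 : ℝ) : ℂ))).PosSemidef)
    (hwr : w * (r / δ) ≤ 1 - w / a) :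
    ∃ col : ι → Fin r, ∀ j,
      (N - diagonal fun i => ((if col i = j then r * w else 0 : ℝ) : ℂ)).PosSemidef := by
  have hS := blockDet_stable (r := r) hN
  set x : ι × Fin r → ℝ := fun _ => -a
  have hA : Above (blockDet r N) x := by
    intro y hy
    refine (Complex.pos_iff.1 (Finset.prod_pos fun j _ => Matrix.PosDef.det_pos ?_)).1
    have : diagonal (fun i => ofR (x + y) (i, j)) + N = (N - diagonal fun _ => (a : ℂ)) +
        diagonal fun i => ((y (i, j) : ℝ) : ℂ) := by
      rw [sub_add_eq_add_sub, add_comm N, add_sub_right_comm, diagonal_sub]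
      congr 2; ext i; simp [ofR, x]; ring
    rw [this]
    exact h1.add_posSemidef (PosSemidef.diagonal fun i => by
      simpa using hy (i, j))
  have hΦ : ∀ k, δ * re (dd k (blockDet r N)) x ≤ re (blockDet r N) x := by
    rintro ⟨i, j⟩
    have h0 : 0 ≤ re (blockDet r N) (x + Pi.single (i, j) (-δ)) := by
      refine (Complex.nonneg_iff.1 (Finset.prod_nonneg fun j' _ => Matrix.PosSemidef.det_nonneg ?_)).1
      by_cases hj : j' = j
      · subst hj
        refine Eq.subst (motive := PosSemidef) ?_ (h2 i)
        rw [sub_eq_neg_add, diagonal_neg]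
        congr 2; ext k
        by_cases hk : k = i
        · subst hk; simp [ofR, x]; ring
        · simp [ofR, x, hk]
      · refine Eq.subst (motive := PosSemidef) ?_ h1.posSemidef
        rw [sub_eq_neg_add, diagonal_neg]
        congr 2; ext k
        simp [ofR, x, hj]
    rw [hS.re_affine] at h0
    linarith
  set J : ι → Finset (ι × Fin r) := fun i => {i} ×ˢ Finset.univ
  have hJ : ∀ i, (J i).card = r := fun i => by simp [J]
  have hJmem : ∀ i k, k ∈ J i ↔ k.1 = i := fun i k => by rw [Finset.mem_product]; simp
  have hbar := Above.oneSubs J hA hS hw ha (fun i => by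
    have hs : δ * ∑ j ∈ J i, re (dd j (blockDet r N)) x ≤ r * re (blockDet r N) x := by
      rw [Finset.mul_sum]
      refine (Finset.sum_le_card_nsmul _ _ _ fun k _ => hΦ k).trans_eq ?_
      rw [hJ, nsmul_eq_mul]
    refine le_trans ?_ (mul_le_mul_of_nonneg_right hwr hA.pos.le)
    rw [mul_assoc]
    refine mul_le_mul_of_nonneg_left ?_ hw.le
    rw [div_mul_eq_mul_div, le_div_iff₀ hδ]
    linarith) Finset.univ.toList
  have hx0 : x + ((Finset.univ : Finset ι).toList.map fun i => Stable.shift (J i) a).sum = 0 := by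
    rw [Finset.sum_map_toList]
    ext k
    simp [Stable.shift, x, hJmem, Finset.sum_apply]
  rw [hx0] at hbar
  obtain ⟨col, hcol, hfin⟩ := Above.exists_choice J hr hJ hw (Finset.nodup_toList _) hS ⟨x, hA⟩ hbar
  have hcol1 : ∀ i, (col i).1 = i := fun i => by simpa [hJmem] using hcol i (by simp)
  refine ⟨fun i => (col i).2, fun j => ?_⟩
  refine (hN.sub (isHermitian_diagonal_ofReal _)).posSemidef_of_det_ne_zero fun t ht h0 => ?_
  have h3 := hfin (fun _ => t) fun _ => ht
  rw [zero_add, re, oneSubs_singleton hS, Finset.sum_map_toList] at h3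
  refine h3.ne' ?_
  rw [blockDet, Finset.prod_eq_zero (Finset.mem_univ j), Complex.zero_re]
  rw [← h0, add_sub_assoc', add_sub_right_comm, diagonal_sub]
  congr 4
  ext i
  have : (∑ i', (Pi.single (col i') ((r * w : ℝ) : ℂ) : ι × Fin r → ℂ)) (i, j) =
      ((if (col i).2 = j then r * w else 0 : ℝ) : ℂ) := by
    rw [Finset.sum_apply, Finset.sum_eq_single i]
    · by_cases h : (col i).2 = j
      · have : col i = (i, j) := Prod.ext (hcol1 i) h
        simp [this]
      · have : (i, j) ≠ col i := fun e => h (by rw [← e])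
        simp [h, this]
    · intro i' _ hne
      have : (i, j) ≠ col i' := fun e => hne (by rw [← hcol1 i', ← e])
      simp [this]
    · simp
  simp only [Pi.sub_apply, this, ofR]

/-- One-sided paving of a positive definite matrix with unit diagonal. -/
lemma exists_color_quadForm_le {K : Matrix ι ι ℂ} (hK : K.PosDef) (hdiag : ∀ i, K i i = 1)
    {a β w : ℝ} (ha : 0 < a) (hβ : 0 < β) (haβ : a * β < 1) (hw : 0 < w) (hr : 0 < r)
    (hKβ : ∀ v, quadForm K v ≤ β * quadForm 1 v) (hwr : w * (r / (1 - a * β)) ≤ 1 - w / a) :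
    ∃ col : ι → Fin r, ∀ j, ∀ v : ι → ℂ, (∀ i, col i ≠ j → v i = 0) →
      r * w * quadForm K v ≤ quadForm 1 v := by
  have hH := hK.isHermitian
  have hunit : IsUnit K := hK.isUnit
  have hdet : IsUnit K.det := (isUnit_iff_isUnit_det K).1 hunit
  have hinv : ∀ x, K *ᵥ (K⁻¹ *ᵥ x) = x := fun x => by
    rw [mulVec_mulVec, mul_nonsing_inv _ hdet, one_mulVec]
  have hinv' : ∀ x, K⁻¹ *ᵥ (K *ᵥ x) = x := fun x => by
    rw [mulVec_mulVec, nonsing_inv_mul _ hdet, one_mulVec]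
  have hNH : K⁻¹.IsHermitian := hH.inv
  have hq : ∀ u, quadForm K⁻¹ (K *ᵥ u) = quadForm K u := fun u => by
    rw [quadForm, hinv', star_mulVec, hH.eq, ← dotProduct_mulVec, quadForm]
  have hpos : ∀ u, 0 ≤ quadForm K u := hK.posSemidef.quadForm_nonneg
  have hnorm : ∀ u, quadForm 1 (K *ᵥ u) ≤ β * quadForm K u := fun u => by
    have h1 := hpos (u - ((1 / β : ℝ) : ℂ) • (K *ᵥ u))
    rw [hH.quadForm_sub_smul] at h1
    have h2 : (star (((1 / β : ℝ) : ℂ)) * (star (K *ᵥ u) ⬝ᵥ K *ᵥ u)).re =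
        1 / β * quadForm 1 (K *ᵥ u) := by
      rw [quadForm, one_mulVec, Complex.star_def, Complex.conj_ofReal, Complex.re_ofReal_mul]
    rw [h2, Complex.normSq_ofReal] at h1
    have h3 := mul_le_mul_of_nonneg_left (hKβ (K *ᵥ u)) (mul_self_nonneg (1 / β))
    have h4 : 1 / β * (1 / β) * (β * quadForm 1 (K *ᵥ u)) = 1 / β * quadForm 1 (K *ᵥ u) := by
      field_simp
    have h5 : 1 / β * quadForm 1 (K *ᵥ u) ≤ quadForm K u := by linarith
    rwa [one_div_mul_eq_div, div_le_iff₀ hβ, mul_comm] at h5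
  have hentry : ∀ u i, Complex.normSq ((K *ᵥ u) i) ≤ quadForm K u := fun u i => by
    have h1 := hpos (u - (K *ᵥ u) i • Pi.single i 1)
    have h2 : quadForm K (Pi.single i 1) = 1 := by
      rw [quadForm, ← Pi.single_star, star_one, single_one_dotProduct, mulVec_single_one]
      simp [hdiag]
    rw [hH.quadForm_sub_smul, h2, ← Pi.single_star, star_one, single_one_dotProduct,
      Complex.star_def, ← Complex.normSq_eq_conj_mul_self, Complex.ofReal_re] at h1
    linarith
  obtain ⟨col, hcol⟩ := exists_color_sub_diagonal_posSemidef (r := r) hNH ha (sub_pos.2 haβ) hw hr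
    ((hNH.sub (isHermitian_diagonal_ofReal _)).posDef_of_quadForm fun x hx => by
      have h1 := hnorm (K⁻¹ *ᵥ x)
      rw [← hq, hinv] at h1
      have h2 : 0 < quadForm 1 x := by
        obtain ⟨i, hi⟩ := Function.ne_iff.1 hx
        rw [quadForm_one]
        exact Finset.sum_pos' (fun _ _ => Complex.normSq_nonneg _)
          ⟨i, Finset.mem_univ i, Complex.normSq_pos.2 hi⟩
      rw [quadForm_sub, quadForm_diagonal, ← Finset.mul_sum, ← quadForm_one, sub_pos]
      refine lt_of_mul_lt_mul_left ?_ hβ.le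
      nlinarith)
    (fun i => (hNH.sub (isHermitian_diagonal_ofReal _)).posSemidef_of_quadForm fun x => by
      have h1 := hnorm (K⁻¹ *ᵥ x)
      have h2 := hentry (K⁻¹ *ᵥ x) i
      rw [← hq, hinv] at h1 h2
      rw [quadForm_sub, quadForm_diagonal]
      simp only [add_mul, Finset.sum_add_distrib, ← Finset.mul_sum, ← quadForm_one, ite_mul,
        zero_mul, Finset.sum_ite_eq', Finset.mem_univ, if_true]
      nlinarith [mul_le_mul_of_nonneg_left h1 ha.le,
        mul_le_mul_of_nonneg_left h2 (sub_pos.2 haβ).le])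
    hwr
  refine ⟨col, fun j v hv => ?_⟩
  have hc : 0 < r * w := by positivity
  have h1 := (hcol j).quadForm_nonneg (K *ᵥ v)
  rw [quadForm_sub, quadForm_diagonal, hq] at h1
  set y : ι → ℂ := fun i => if col i = j then (K *ᵥ v) i else 0 with hy
  have hy1 : quadForm 1 y = ∑ i, if col i = j then Complex.normSq ((K *ᵥ v) i) else 0 := by
    rw [quadForm_one]
    refine Finset.sum_congr rfl fun i _ => ?_
    simp only [hy]; split_ifs <;> simp
  have hy2 : (star y ⬝ᵥ (1 : Matrix ι ι ℂ) *ᵥ v).re = quadForm K v := by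
    have h3 : star y ⬝ᵥ v = star (K *ᵥ v) ⬝ᵥ v := by
      refine Finset.sum_congr rfl fun i _ => ?_
      by_cases h : col i = j
      · simp [hy, h]
      · simp [hv i h]
    rw [one_mulVec, h3, star_mulVec, hH.eq, ← dotProduct_mulVec, quadForm]
  have h2 : 0 ≤ quadForm 1 (v - ((r * w : ℝ) : ℂ) • y) := PosSemidef.one.quadForm_nonneg _
  rw [isHermitian_one.quadForm_sub_smul, Complex.star_def, Complex.conj_ofReal,
    Complex.re_ofReal_mul, hy2, Complex.normSq_ofReal, hy1] at h2
  simp only [ite_mul, zero_mul, ← Finset.sum_filter, ← Finset.mul_sum] at h1 h2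
  nlinarith

end Paving

section Ordering

open scoped Matrix.Norms.L2Operator

variable {ι : Type*}

open Classical in
/-- The matrix `A` with the entries outside of `p` set to zero. -/
noncomputable def mask (p : ι → ι → Prop) (A : Matrix ι ι ℂ) : Matrix ι ι ℂ :=
  of fun i j => if p i j then A i j else 0

variable {p : ι → ι → Prop} {i j : ι}

lemma mask_of (h : p i j) {A : Matrix ι ι ℂ} : mask p A i j = A i j := if_pos h

lemma mask_of_not (h : ¬ p i j) {A : Matrix ι ι ℂ} : mask p A i j = 0 := if_neg h

lemma mask_mask (p q : ι → ι → Prop) (A : Matrix ι ι ℂ) :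
    mask p (mask q A) = mask (fun i j => p i j ∧ q i j) A := by
  ext i j
  by_cases h : p i j
  · by_cases h' : q i j
    · rw [mask_of h, mask_of h', mask_of ⟨h, h'⟩]
    · rw [mask_of h, mask_of_not h', mask_of_not fun H => h' H.2]
  · rw [mask_of_not h, mask_of_not fun H => h H.1]

lemma mask_congr {p q : ι → ι → Prop} {A : Matrix ι ι ℂ} (h : ∀ i j, p i j ↔ q i j) :
    mask p A = mask q A := congrArg (mask · A) (by ext i j; exact h i j)

lemma Matrix.IsHermitian.mask {A : Matrix ι ι ℂ} (hA : A.IsHermitian) {p : ι → ι → Prop}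
    (hp : ∀ i j, p i j ↔ p j i) : (mask p A).IsHermitian := by
  ext i j
  by_cases h : p i j
  · simp [_root_.mask, h, (hp i j).1 h, hA.apply]
  · simp [_root_.mask, h, mt (hp i j).2 h]

variable [Fintype ι] [DecidableEq ι]

lemma quadForm_one_eq_norm_sq (v : ι → ℂ) : quadForm 1 v = ‖WithLp.toLp 2 v‖ ^ 2 := by
  rw [quadForm_one, EuclideanSpace.norm_sq_eq]
  simp [Complex.normSq_eq_norm_sq]

lemma Matrix.quadForm_one_mulVec_le (M : Matrix ι ι ℂ) (v : ι → ℂ) :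
    quadForm 1 (M *ᵥ v) ≤ ‖M‖ ^ 2 * quadForm 1 v := by
  rw [quadForm_one_eq_norm_sq, quadForm_one_eq_norm_sq, ← mul_pow]
  exact pow_le_pow_left₀ (norm_nonneg _) (l2_opNorm_mulVec M (WithLp.toLp 2 v)) 2

lemma Matrix.l2_opNorm_le_of_quadForm {M : Matrix ι ι ℂ} {γ : ℝ} (hγ : 0 ≤ γ)
    (h : ∀ v, quadForm 1 (M *ᵥ v) ≤ γ ^ 2 * quadForm 1 v) : ‖M‖ ≤ γ := by
  rw [cstar_norm_def]
  refine ContinuousLinearMap.opNorm_le_bound _ hγ fun v => ?_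
  have := h v.ofLp
  rw [quadForm_one_eq_norm_sq, quadForm_one_eq_norm_sq, ← mul_pow] at this
  exact le_of_sq_le_sq this (by positivity)

lemma Matrix.abs_quadForm_le (M : Matrix ι ι ℂ) (v : ι → ℂ) :
    |quadForm M v| ≤ ‖M‖ * quadForm 1 v := by
  have e : quadForm M v = (inner ℂ (WithLp.toLp 2 v) (WithLp.toLp 2 (M *ᵥ v))).re := by
    rw [EuclideanSpace.inner_toLp_toLp, dotProduct_comm]; rfl
  rw [e, quadForm_one_eq_norm_sq]
  refine (Complex.abs_re_le_norm _).trans ((norm_inner_le_norm _ _).trans ?_)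
  have : ‖WithLp.toLp 2 (M *ᵥ v)‖ ≤ ‖M‖ * ‖WithLp.toLp 2 v‖ :=
    l2_opNorm_mulVec M (WithLp.toLp 2 v)
  nlinarith [norm_nonneg (WithLp.toLp 2 v)]

lemma Matrix.IsHermitian.l2_opNorm_le {M : Matrix ι ι ℂ} (hM : M.IsHermitian) {γ : ℝ}
    (hγ : 0 ≤ γ) (h : ∀ v, |quadForm M v| ≤ γ * quadForm 1 v) : ‖M‖ ≤ γ := by
  rw [cstar_norm_def, ContinuousLinearMap.norm_eq_iSup_rayleighQuotient]
  · refine ciSup_le fun v => ?_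
    have e : (toEuclideanCLM (n := ι) (𝕜 := ℂ) M).reApplyInnerSelf v = quadForm M v.ofLp := by
      rw [ContinuousLinearMap.reApplyInnerSelf_apply, inner_re_symm,
        EuclideanSpace.inner_eq_star_dotProduct, dotProduct_comm]
      rfl
    rw [ContinuousLinearMap.rayleighQuotient, e, abs_div, abs_sq]
    refine div_le_of_le_mul₀ (by positivity) hγ ?_
    have := h v.ofLp
    rwa [quadForm_one_eq_norm_sq] at this
  · exact isSymmetric_toEuclideanLin_iff.2 hM

lemma l2_opNorm_mask_prod_le (s t : Set ι) (A : Matrix ι ι ℂ) :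
    ‖mask (fun i j => i ∈ s ∧ j ∈ t) A‖ ≤ ‖A‖ := by
  classical
  have hd : ∀ s : Set ι, ‖diagonal (fun i => if i ∈ s then (1 : ℂ) else 0)‖ ≤ 1 := fun s => by
    rw [l2_opNorm_diagonal, pi_norm_le_iff_of_nonneg zero_le_one]
    intro i; split_ifs <;> simp
  have e : mask (fun i j => i ∈ s ∧ j ∈ t) A = diagonal (fun i => if i ∈ s then (1 : ℂ) else 0) *
      A * diagonal (fun i => if i ∈ t then (1 : ℂ) else 0) := by
    ext i j
    by_cases h : i ∈ s <;> by_cases h' : j ∈ t <;> simp [mask, h, h']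
  rw [e]
  calc _ ≤ ‖diagonal (fun i => if i ∈ s then (1 : ℂ) else 0)‖ * ‖A‖ *
        ‖diagonal (fun i => if i ∈ t then (1 : ℂ) else 0)‖ :=
        (norm_mul_le _ _).trans (mul_le_mul_of_nonneg_right (norm_mul_le _ _) (norm_nonneg _))
    _ ≤ 1 * ‖A‖ * 1 := by gcongr <;> exact hd _
    _ = ‖A‖ := by ring

/-- The norm of a block diagonal matrix is controlled by those of its blocks. -/
lemma l2_opNorm_mask_eq_le {κ : Type*} [Finite κ] (c : ι → κ) {A : Matrix ι ι ℂ} {γ : ℝ} (hγ : 0 ≤ γ)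
    (h : ∀ k, ‖mask (fun i j => c i = k ∧ c j = k) A‖ ≤ γ) :
    ‖mask (fun i j => c i = c j) A‖ ≤ γ := by
  classical
  have := Fintype.ofFinite κ
  refine l2_opNorm_le_of_quadForm hγ fun v => ?_
  set vk : κ → ι → ℂ := fun k i => if c i = k then v i else 0 with hvk
  have e1 : ∀ k i, c i = k → (mask (fun i j => c i = c j) A *ᵥ v) i =
      (mask (fun i j => c i = k ∧ c j = k) A *ᵥ vk k) i := by
    rintro _ i rfl
    refine Finset.sum_congr rfl fun j _ => ?_
    by_cases hj : c j = c i
    · simp [mask, hvk, hj]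
    · simp [mask, hvk, hj, Ne.symm hj]
  have e2 : ∀ k, ∑ i with c i = k, Complex.normSq ((mask (fun i j => c i = c j) A *ᵥ v) i) ≤
      γ ^ 2 * ∑ i with c i = k, Complex.normSq (v i) := fun k => by
    calc _ = ∑ i with c i = k, Complex.normSq ((mask (fun i j => c i = k ∧ c j = k) A *ᵥ vk k) i) :=
          Finset.sum_congr rfl fun i hi => by rw [e1 k i (Finset.mem_filter.1 hi).2]
      _ ≤ quadForm 1 (mask (fun i j => c i = k ∧ c j = k) A *ᵥ vk k) := by
          rw [quadForm_one]
          exact Finset.sum_le_univ_sum_of_nonneg fun i => Complex.normSq_nonneg _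
      _ ≤ γ ^ 2 * quadForm 1 (vk k) := (quadForm_one_mulVec_le _ _).trans (by
          rw [quadForm_one]
          have := h k
          gcongr
          exact Finset.sum_nonneg fun i _ => Complex.normSq_nonneg _)
      _ = _ := by
          rw [quadForm_one, Finset.sum_filter]
          congr 1
          refine Finset.sum_congr rfl fun i _ => ?_
          simp only [hvk]; split_ifs <;> simp
  rw [quadForm_one, quadForm_one, ← Finset.sum_fiberwise _ c, ← Finset.sum_fiberwise _ c,
    Finset.mul_sum]
  exact Finset.sum_le_sum fun k _ => e2 k

/-- Block triangular truncation loses at most a logarithm of the number of blocks. -/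
lemma l2_opNorm_mask_lt_le (m : ℕ) (c : ι → ℕ) (hc : ∀ i, c i < 2 ^ m) (A : Matrix ι ι ℂ) :
    ‖mask (fun i j => c j < c i) A‖ ≤ m * ‖A‖ := by
  induction m generalizing c with
  | zero =>
    have : mask (fun i j => c j < c i) A = 0 := by
      ext i j
      have := hc i
      have := hc j
      simp [mask, show ¬ c j < c i by omega]
    simp [this]
  | succ m ih =>
    have hc2 : ∀ i, c i / 2 < 2 ^ m := fun i => by have := hc i; rw [pow_succ] at this; omega
    have h1 := ih (fun i => c i / 2) hc2
    set X := mask (fun i j => c i % 2 = 1 ∧ c j % 2 = 0) A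
    have hXA : ‖X‖ ≤ ‖A‖ := l2_opNorm_mask_prod_le {i | c i % 2 = 1} {j | c j % 2 = 0} A
    set d : ι → Fin (2 ^ m) := fun i => ⟨c i / 2, hc2 i⟩
    have hd : ∀ i j, d i = d j ↔ c i / 2 = c j / 2 := fun i j => Fin.ext_iff
    have h2 : ‖mask (fun i j => d i = d j) X‖ ≤ ‖A‖ :=
      l2_opNorm_mask_eq_le d (norm_nonneg A) fun k =>
        (l2_opNorm_mask_prod_le {i | d i = k} {i | d i = k} X).trans hXA
    have e : mask (fun i j => c j < c i) A = mask (fun i j => c j / 2 < c i / 2) A +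
        mask (fun i j => d i = d j) X := by
      rw [mask_mask]
      ext i j
      simp only [mask, Matrix.add_apply, of_apply, hd]
      split_ifs <;> first | omega | simp
    rw [e]
    refine (norm_add_le _ _).trans ?_
    push_cast
    linarith

lemma exists_paving {A : Matrix ι ι ℂ} (hA : A.IsHermitian) (hdiag : ∀ i, A i i = 0)
    (h : ∀ v, |quadForm A v| ≤ quadForm 1 v) :
    ∃ c : ι → Fin (2 ^ 14), ∀ k, ∀ v : ι → ℂ, (∀ i, c i ≠ k → v i = 0) →
      |quadForm A v| ≤ 1 / 2 * quadForm 1 v := by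
  have hone : ∀ v : ι → ℂ, v ≠ 0 → 0 < quadForm 1 v := fun v hv => by
    rw [quadForm_one_eq_norm_sq]
    have : WithLp.toLp 2 v ≠ 0 := by simpa using hv
    positivity
  have key : ∀ s : ℝ, |s| = 1 → ∃ c : ι → Fin 128, ∀ k, ∀ v : ι → ℂ, (∀ i, c i ≠ k → v i = 0) →
      s * quadForm A v ≤ 1 / 2 * quadForm 1 v := by
    intro s hs
    set K : Matrix ι ι ℂ := 1 + ((s / 2 : ℝ) : ℂ) • A with hK
    have hKq : ∀ v, quadForm K v = quadForm 1 v + s / 2 * quadForm A v := fun v => by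
      simp only [hK, quadForm, add_mulVec, smul_mulVec, dotProduct_add, dotProduct_smul,
        Complex.add_re, smul_eq_mul, Complex.re_ofReal_mul]
    have habs : ∀ v, |s * quadForm A v| ≤ quadForm 1 v := fun v => by
      rw [abs_mul, hs, one_mul]; exact h v
    have hKH : K.IsHermitian := isHermitian_one.add (by
      ext i j
      simp [hA.apply])
    obtain ⟨c, hc⟩ := exists_color_quadForm_le (r := 128) (w := 1 / 160) (a := 1 / 15) (β := 3 / 2)
      (hKH.posDef_of_quadForm fun v hv => by
        rw [hKq]; have := abs_le.1 (habs v); have := hone v hv; linarith)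
      (fun i => by simp [hK, hdiag]) (by norm_num) (by norm_num) (by norm_num) (by norm_num)
      (by norm_num) (fun v => by rw [hKq]; have := abs_le.1 (habs v); linarith) (by norm_num)
    refine ⟨c, fun k v hv => ?_⟩
    have := hc k v hv
    rw [hKq] at this
    norm_num at this
    linarith
  obtain ⟨c₁, h₁⟩ := key 1 (by simp)
  obtain ⟨c₂, h₂⟩ := key (-1) (by simp)
  let e : Fin 128 × Fin 128 ≃ Fin (2 ^ 14) := finProdFinEquiv
  refine ⟨fun i => e (c₁ i, c₂ i), fun k v hv => ?_⟩
  have hne : ∀ i, (c₁ i, c₂ i) ≠ e.symm k → v i = 0 := fun i hi =>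
    hv i fun h => hi (e.eq_symm_apply.2 h)
  rw [abs_le]
  have g₁ := h₁ (e.symm k).1 v fun i hi => hne i fun h => hi (by rw [← h])
  have g₂ := h₂ (e.symm k).2 v fun i hi => hne i fun h => hi (by rw [← h])
  constructor <;> linarith

lemma exists_paving_mask {A : Matrix ι ι ℂ} (hA : A.IsHermitian) (hdiag : ∀ i, A i i = 0) :
    ∃ c : ι → Fin (2 ^ 14), ∀ k, ‖mask (fun i j => c i = k ∧ c j = k) A‖ ≤ ‖A‖ / 2 := by
  rcases (norm_nonneg A).eq_or_lt with h0 | h0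
  · refine ⟨fun _ => 0, fun k => (l2_opNorm_mask_prod_le {_i | 0 = k} {_i | 0 = k} A).trans ?_⟩
    rw [← h0]; simp
  have hs : ∀ v, quadForm (((1 / ‖A‖ : ℝ) : ℂ) • A) v = quadForm A v / ‖A‖ := fun v => by
    simp only [quadForm, smul_mulVec, dotProduct_smul, smul_eq_mul, Complex.re_ofReal_mul]
    ring
  obtain ⟨c, hc⟩ := exists_paving (A := ((1 / ‖A‖ : ℝ) : ℂ) • A) (by ext i j; simp [hA.apply])
    (fun i => by simp [hdiag]) (fun v => by
      rw [hs, abs_div, abs_norm, div_le_iff₀ h0, mul_comm]; exact A.abs_quadForm_le v)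
  refine ⟨c, fun k => ?_⟩
  refine (hA.mask fun i j => and_comm).l2_opNorm_le (by positivity) fun v => ?_
  set u : ι → ℂ := fun i => if c i = k then v i else 0 with hu
  have e1 : quadForm (mask (fun i j => c i = k ∧ c j = k) A) v = quadForm A u := by
    simp only [quadForm, dotProduct, mulVec]
    congr 1
    refine Finset.sum_congr rfl fun i _ => ?_
    by_cases hi : c i = k
    · simp [mask, hu, hi]
    · simp [mask, hu, hi]
  have e2 : quadForm 1 u ≤ quadForm 1 v := by
    rw [quadForm_one, quadForm_one]
    refine Finset.sum_le_sum fun i _ => ?_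
    simp only [hu]; split_ifs
    · exact le_rfl
    · simp [Complex.normSq_nonneg]
  have := hc k u fun i hi => by simp [hu, hi]
  rw [hs, abs_div, abs_norm, div_le_iff₀ h0] at this
  rw [e1]
  nlinarith

/-- A Hermitian matrix with zero diagonal can be ordered so that its triangular part is bounded. -/
lemma exists_key {A : Matrix ι ι ℂ} (hA : A.IsHermitian) (hdiag : ∀ i, A i i = 0) (S : Finset ι) :
    ∃ k : ι → ℕ, Set.InjOn k S ∧ ‖mask (fun i j => k j < k i) (mask (fun i j => i ∈ S ∧ j ∈ S) A)‖ ≤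
      28 * ‖mask (fun i j => i ∈ S ∧ j ∈ S) A‖ := by
  induction S using Finset.strongInduction with
  | H S ih =>
  set X := mask (fun i j => i ∈ S ∧ j ∈ S) A with hX
  have hXH : X.IsHermitian := hA.mask fun i j => and_comm
  rcases (norm_nonneg X).eq_or_lt with h0 | h0
  · refine ⟨fun i => Fintype.equivFin ι i, fun i _ j _ h => ?_, ?_⟩
    · exact (Fintype.equivFin ι).injective (Fin.ext h)
    · rw [norm_eq_zero.1 h0.symm, show mask _ (0 : Matrix ι ι ℂ) = 0 by ext; simp [mask]]
      simp
  obtain ⟨c, hc⟩ := exists_paving_mask hXH fun i => by simp [hX, mask, hdiag]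
  set T : Fin (2 ^ 14) → Finset ι := fun a => S.filter fun i => c i = a with hT
  have hTX : ∀ a, mask (fun i j => i ∈ T a ∧ j ∈ T a) A = mask (fun i j => c i = a ∧ c j = a) X :=
    fun a => by
      rw [hX, mask_mask]
      exact mask_congr fun i j => by simp only [hT, Finset.mem_filter]; tauto
  have hss : ∀ a, T a ⊂ S := fun a => by
    refine (Finset.filter_subset _ _).ssubset_of_ne fun heq => ?_
    have := hc a
    rw [← hTX, show T a = S from heq, ← hX] at this
    linarith
  choose κ hinj hκ using fun a => ih (T a) (hss a)
  set M := (∑ a, ∑ i, κ a i) + 1 with hM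
  have hlt : ∀ a i, κ a i < M := fun a i => by
    have h1 := Finset.single_le_sum (f := fun i => κ a i) (fun _ _ => Nat.zero_le _)
      (Finset.mem_univ i)
    have h2 := Finset.single_le_sum (f := fun a => ∑ i, κ a i) (fun _ _ => Nat.zero_le _)
      (Finset.mem_univ a)
    omega
  set k : ι → ℕ := fun i => (c i : ℕ) * M + κ (c i) i with hk
  have hdiv : ∀ i, k i / M = c i := fun i => by
    rw [hk]; dsimp only
    rw [mul_comm, Nat.mul_add_div (by omega), Nat.div_eq_of_lt (hlt _ _), add_zero]
  have hmod : ∀ i, k i % M = κ (c i) i := fun i => by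
    rw [hk]; dsimp only
    rw [mul_comm, Nat.mul_add_mod, Nat.mod_eq_of_lt (hlt _ _)]
  have hkc : ∀ i j, c i = c j → (k j < k i ↔ κ (c i) j < κ (c i) i) := fun i j h => by
    simp only [hk, h]; omega
  have hkne : ∀ i j, c i ≠ c j → (k j < k i ↔ (c j : ℕ) < c i) := fun i j h => by
    have hne : (c i : ℕ) ≠ c j := fun e => h (Fin.ext e)
    rw [← hdiv, ← hdiv] at hne ⊢
    constructor
    · intro hlt; exact lt_of_le_of_ne (Nat.div_le_div_right hlt.le) (Ne.symm hne)
    · exact Nat.lt_of_div_lt_div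
  refine ⟨k, fun i hi j hj h => ?_, ?_⟩
  · have h1 : c i = c j := Fin.ext (by rw [← hdiv, ← hdiv, h])
    have h2 := hmod i
    rw [h, hmod, ← h1] at h2
    exact hinj (c i) (by simpa [hT] using hi) (by simpa [hT, h1] using hj) h2.symm
  · set Y := mask (fun i j => κ (c i) j < κ (c i) i) X with hY
    have e : mask (fun i j => k j < k i) X =
        mask (fun i j => (c j : ℕ) < c i) X + mask (fun i j => c i = c j) Y := by
      ext i j
      by_cases h : c i = c j
      · simp [mask, hY, hkc i j h, h]
      · simp [mask, hkne i j h, h]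
    have hY2 : ‖mask (fun i j => c i = c j) Y‖ ≤ 28 * (‖X‖ / 2) := by
      refine l2_opNorm_mask_eq_le c (by positivity) fun a => ?_
      have : mask (fun i j => c i = a ∧ c j = a) Y = mask (fun i j => κ a j < κ a i)
          (mask (fun i j => i ∈ T a ∧ j ∈ T a) A) := by
        rw [hTX, hY, mask_mask (A := X), mask_mask (A := X)]
        exact mask_congr fun i j => by
          constructor
          · rintro ⟨⟨rfl, h⟩, h'⟩; exact ⟨h', rfl, h⟩
          · rintro ⟨h', rfl, h⟩; exact ⟨⟨rfl, h⟩, h'⟩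
      rw [this]
      refine (hκ a).trans ?_
      rw [hTX]
      have := hc a
      linarith
    have hX1 := l2_opNorm_mask_lt_le 14 (fun i => (c i : ℕ)) (fun i => (c i).isLt) X
    rw [e]
    refine (norm_add_le _ _).trans ?_
    push_cast at hX1
    linarith

lemma l2_opNorm_submatrix_equiv_le (M : Matrix ι ι ℂ) (σ : Equiv.Perm ι) :
    ‖M.submatrix σ σ‖ ≤ ‖M‖ := by
  refine l2_opNorm_le_of_quadForm (norm_nonneg M) fun v => ?_
  have h := M.quadForm_one_mulVec_le (v ∘ σ.symm)
  have e : ∀ v : ι → ℂ, quadForm 1 (v ∘ σ) = quadForm 1 v := fun v => by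
    rw [quadForm_one, quadForm_one]
    exact Equiv.sum_comp σ fun i => Complex.normSq (v i)
  rw [submatrix_mulVec_equiv, e]
  rwa [← e (v ∘ σ.symm), Function.comp_assoc, Equiv.symm_comp_self, Function.comp_id] at h

lemma Matrix.PosSemidef.l2_opNorm_sub_one_le {B : Matrix ι ι ℂ} (hB : B.PosSemidef)
    (hdiag : ∀ i, B i i = 1) : ‖B - 1‖ ≤ ‖B‖ := by
  refine (hB.isHermitian.sub isHermitian_one).l2_opNorm_le (norm_nonneg B) fun v => ?_
  rcases isEmpty_or_nonempty ι with hι | ⟨⟨i⟩⟩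
  · simp [quadForm]
  have h1 : 1 ≤ ‖B‖ := by
    have h := B.abs_quadForm_le (Pi.single i 1)
    have e : ∀ M : Matrix ι ι ℂ, quadForm M (Pi.single i 1) = (M i i).re := fun M => by
      rw [quadForm, ← Pi.single_star, star_one, single_one_dotProduct, mulVec_single_one]; rfl
    rw [e, e, hdiag] at h
    simpa using h
  have h2 := hB.quadForm_nonneg v
  have h3 := (abs_le.1 (B.abs_quadForm_le v)).2
  have h4 : 0 ≤ quadForm 1 v := PosSemidef.one.quadForm_nonneg v
  rw [quadForm_sub, abs_le]
  constructor <;> nlinarith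

lemma exists_perm_specNorm_lowerTri_le {n : ℕ} {B : Matrix (Fin n) (Fin n) ℂ}
    (hB : B.PosSemidef) (hdiag : ∀ i, B i i = 1) :
    ∃ σ : Equiv.Perm (Fin n), specNorm (lowerTri (B.submatrix σ σ)) ≤ 28 * specNorm B := by
  obtain ⟨k, hinj, hk⟩ := exists_key (A := B - 1) (hB.isHermitian.sub isHermitian_one)
    (fun i => by simp [hdiag]) Finset.univ
  rw [show mask (fun i j => i ∈ Finset.univ ∧ j ∈ Finset.univ) (B - 1) = B - 1 by
    ext; simp [mask]] at hk
  have hmono : StrictMono (k ∘ Tuple.sort k) :=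
    (Tuple.monotone_sort k).strictMono_of_injective
      ((Set.injOn_univ.1 (by simpa using hinj)).comp (Tuple.sort k).injective)
  refine ⟨Tuple.sort k, ?_⟩
  have e : lowerTri (B.submatrix (Tuple.sort k) (Tuple.sort k)) =
      (mask (fun i j => k j < k i) (B - 1)).submatrix (Tuple.sort k) (Tuple.sort k) := by
    ext a b
    have hlt : k (Tuple.sort k b) < k (Tuple.sort k a) ↔ b < a := hmono.lt_iff_lt
    by_cases h : b < a
    · simp [lowerTri, mask, hlt, h, one_apply, h.ne']
    · simp [lowerTri, mask, hlt, h]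
  calc specNorm (lowerTri (B.submatrix (Tuple.sort k) (Tuple.sort k)))
      ≤ ‖mask (fun i j => k j < k i) (B - 1)‖ := by
        rw [e]; exact l2_opNorm_submatrix_equiv_le _ _
    _ ≤ 28 * ‖B - 1‖ := hk
    _ ≤ 28 * ‖B‖ := by gcongr; exact hB.l2_opNorm_sub_one_le hdiag

end Ordering

end

/-- For every positive semi-definite B with unit diagonal some reordering σ gives
‖L_σ‖ ≤ C₁‖B‖ with an absolute constant C₁ ≤ 32.42. -/
theorem exists_perm_lowerTri_bound_psd :
    ∃ C₁ : ℝ, C₁ ≤ 32.42 ∧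
      ∀ (n : ℕ) (B : Matrix (Fin n) (Fin n) ℂ), B.PosSemidef → (∀ i, B i i = 1) →
        ∃ σ : Equiv.Perm (Fin n),
          specNorm (lowerTri (B.submatrix σ σ)) ≤ C₁ * specNorm B :=
  ⟨28, by norm_num, fun _ _ => exists_perm_specNorm_lowerTri_le⟩
end

section
/- Let B be an n×n complex Hermitian positive semi-definite matrix with unit diagonal, λ₁ its largest eigenvalue, λ_r its smallest nonzero eigenvalue, κ̄ = λ₁/λ_r. Let b ∈ Ran(B), ȳ a solution of Bȳ = b, and fix ω ∈ (0,2). Define the shuffled SOR iteration: at step k, given y^{(k)} and a permutation σ of {1,…,n}, set y^{(k+1)} = y^{(k)} + ω P_σ*(I + ωL_σ)^{-1} P_σ (b − B y^{(k)}), where L_σ is the strictly lower triangular part of P_σ B P_σ*. Then for every k ≥ 1, the average of |ȳ − y^{(k)}|_B² over all (n!)^k sequences (σ₁,…,σ_k) of permutations (each chosen uniformly and independently) satisfies E(|ȳ − y^{(k)}|_B²) ≤ (1 − ω(2−ω)λ₁ / ((1 + ωλ₁)² κ̄))^k · |ȳ − y^{(0)}|_B². -/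
open Matrix
open scoped ComplexOrder

/-- One SOR sweep for the σ-permuted system, expressed in the original ordering:
v ↦ v + ω P_σ* (I + ω L_σ)⁻¹ P_σ (b − B v), where L_σ is the strictly lower
triangular part of P_σ B P_σ*. -/
noncomputable def sorStepPerm {n : ℕ} (B : Matrix (Fin n) (Fin n) ℂ) (ω : ℝ)
    (b : Fin n → ℂ) (σ : Equiv.Perm (Fin n)) (v : Fin n → ℂ) : Fin n → ℂ :=
  v + (ω : ℂ) • fun i =>
    ((1 + (ω : ℂ) • lowerTri (B.submatrix σ σ))⁻¹ *ᵥ fun j => (b - B *ᵥ v) (σ j))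
      (σ.symm i)

section
variable {n : ℕ}

/-- The number of permutations listing `i` before both `j` and `k` is `n! / 3`, or `n! / 2` when
`j = k`. -/
theorem six_mul_sum_precedes (i j k : Fin n) (hj : j ≠ i) (hk : k ≠ i) :
    6 * ∑ σ : Equiv.Perm (Fin n),
        ((if σ.symm i < σ.symm j then (1 : ℂ) else 0) * if σ.symm i < σ.symm k then 1 else 0) =
      (n.factorial : ℂ) * (2 + if j = k then 1 else 0) := by
  have hinv : ∀ (π : Equiv.Perm (Fin n)) (a b c : Fin n),
      ∑ σ : Equiv.Perm (Fin n),
        ((if σ.symm a < σ.symm b then (1 : ℂ) else 0) * if σ.symm a < σ.symm c then 1 else 0) =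
      ∑ σ : Equiv.Perm (Fin n), ((if σ.symm (π a) < σ.symm (π b) then (1 : ℂ) else 0) *
        if σ.symm (π a) < σ.symm (π c) then 1 else 0) := by
    intro π a b c
    refine Fintype.sum_equiv (Equiv.mulLeft π) _ _ fun σ => ?_
    have h : ∀ x, (π * σ).symm (π x) = σ.symm x := fun x => by
      rw [Equiv.symm_apply_eq]; simp
    simp [h]
  have hcard : ∑ _σ : Equiv.Perm (Fin n), (1 : ℂ) = n.factorial := by
    simp [Fintype.card_perm]
  by_cases hjk : j = k
  · subst hjk
    have h1 := hinv (Equiv.swap i j) i j j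
    simp only [Equiv.swap_apply_left, Equiv.swap_apply_right] at h1
    have h2 : ∑ σ : Equiv.Perm (Fin n), (((if σ.symm i < σ.symm j then (1 : ℂ) else 0) *
        if σ.symm i < σ.symm j then 1 else 0) + (if σ.symm j < σ.symm i then (1 : ℂ) else 0) *
        if σ.symm j < σ.symm i then 1 else 0) = n.factorial := by
      rw [← hcard]
      refine Finset.sum_congr rfl fun σ _ => ?_
      have : σ.symm j ≠ σ.symm i := fun h => hj (σ.symm.injective h)
      rcases lt_or_gt_of_ne this with h | h <;> simp [h, h.not_gt]
    rw [Finset.sum_add_distrib] at h2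
    simp only [if_true]
    linear_combination 3 * h1 + 3 * h2
  · have h1 := hinv (Equiv.swap i j) i j k
    have h2 := hinv (Equiv.swap i k) i j k
    simp only [Equiv.swap_apply_left, Equiv.swap_apply_right,
      Equiv.swap_apply_of_ne_of_ne hk (Ne.symm hjk), Equiv.swap_apply_of_ne_of_ne hj hjk] at h1 h2
    have h3 : ∑ σ : Equiv.Perm (Fin n), (((if σ.symm i < σ.symm j then (1 : ℂ) else 0) *
        if σ.symm i < σ.symm k then 1 else 0) + ((if σ.symm j < σ.symm i then (1 : ℂ) else 0) *
        if σ.symm j < σ.symm k then 1 else 0) + (if σ.symm k < σ.symm j then (1 : ℂ) else 0) *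
        if σ.symm k < σ.symm i then 1 else 0) = n.factorial := by
      rw [← hcard]
      refine Finset.sum_congr rfl fun σ _ => ?_
      have e1 : σ.symm j ≠ σ.symm i := fun h => hj (σ.symm.injective h)
      have e2 : σ.symm k ≠ σ.symm i := fun h => hk (σ.symm.injective h)
      have e3 : σ.symm j ≠ σ.symm k := fun h => hjk (σ.symm.injective h)
      split_ifs <;> first | omega | simp
    rw [Finset.sum_add_distrib, Finset.sum_add_distrib] at h3
    simp only [hjk, if_false]
    linear_combination 2 * h1 + 2 * h2 + 2 * h3

/-- The part of `M` coupling each index to those listed before it by `σ`, in the original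
ordering. -/
def precedingPart (M : Matrix (Fin n) (Fin n) ℂ) (σ : Equiv.Perm (Fin n)) :
    Matrix (Fin n) (Fin n) ℂ :=
  Matrix.of fun i j => if σ.symm j < σ.symm i then M i j else 0

theorem precedingPart_add_conjTranspose {B : Matrix (Fin n) (Fin n) ℂ} (hB : B.IsHermitian)
    (hdiag : ∀ i, B i i = 1) (σ : Equiv.Perm (Fin n)) :
    precedingPart B σ + (precedingPart B σ)ᴴ + 1 = B := by
  ext i j
  have hBij : star (B j i) = B i j := hB.apply i j
  by_cases hij : i = j
  · subst hij; simp [precedingPart, hdiag]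
  · have : σ.symm i ≠ σ.symm j := fun h => hij (σ.symm.injective h)
    rcases lt_or_gt_of_ne this with h | h
    · simpa [precedingPart, h, h.not_gt, hij] using hBij
    · simp [precedingPart, h, h.not_gt, hij]

theorem re_star_dotProduct_comm (u v : Fin n → ℂ) :
    (star u ⬝ᵥ v).re = (star v ⬝ᵥ u).re := by
  rw [star_dotProduct, Complex.star_def, Complex.conj_re]

theorem re_star_dotProduct_conjTranspose_mulVec (M : Matrix (Fin n) (Fin n) ℂ) (v : Fin n → ℂ) :
    (star v ⬝ᵥ (Mᴴ *ᵥ v)).re = (star v ⬝ᵥ (M *ᵥ v)).re := by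
  rw [dotProduct_mulVec, ← star_mulVec, re_star_dotProduct_comm]

theorem two_mul_re_precedingPart {B : Matrix (Fin n) (Fin n) ℂ} (hB : B.IsHermitian)
    (hdiag : ∀ i, B i i = 1) (σ : Equiv.Perm (Fin n)) (v : Fin n → ℂ) :
    2 * (star v ⬝ᵥ (precedingPart B σ *ᵥ v)).re = energySq B v - (star v ⬝ᵥ v).re := by
  have h := congrArg (fun M => (star v ⬝ᵥ (M *ᵥ v)).re)
    (precedingPart_add_conjTranspose hB hdiag σ)
  simp only [add_mulVec, dotProduct_add, Complex.add_re, one_mulVec,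
    re_star_dotProduct_conjTranspose_mulVec] at h
  unfold energySq
  linarith

theorem det_one_add_smul_lowerTri (M : Matrix (Fin n) (Fin n) ℂ) (c : ℂ) :
    (1 + c • lowerTri M).det = 1 := by
  rw [det_of_isLowerTriangular]
  · simp [lowerTri]
  · intro i j hij
    have hij' : i < j := by simpa using hij
    simp [lowerTri, hij'.not_gt, hij'.ne]

/-- The correction made by a sweep solves a triangular system in the original ordering. -/
theorem exists_sorStepPerm_eq (B : Matrix (Fin n) (Fin n) ℂ) (ω : ℝ) (b : Fin n → ℂ)
    (σ : Equiv.Perm (Fin n)) (v : Fin n → ℂ) :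
    ∃ w : Fin n → ℂ, sorStepPerm B ω b σ v = v + (ω : ℂ) • w ∧
      w + (ω : ℂ) • (precedingPart B σ *ᵥ w) = b - B *ᵥ v := by
  refine ⟨_, rfl, ?_⟩
  set u := (1 + (ω : ℂ) • lowerTri (B.submatrix σ σ))⁻¹ *ᵥ fun j => (b - B *ᵥ v) (σ j) with hu
  have h : (1 + (ω : ℂ) • lowerTri (B.submatrix σ σ)) *ᵥ u = fun j => (b - B *ᵥ v) (σ j) := by
    rw [hu, mulVec_mulVec, mul_nonsing_inv _ (by rw [det_one_add_smul_lowerTri]; exact isUnit_one),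
      one_mulVec]
  funext i
  have hi := congrFun h (σ.symm i)
  simp only [Equiv.apply_symm_apply, add_mulVec, one_mulVec, smul_mulVec] at hi
  rw [← hi]
  simp only [Pi.add_apply, Pi.smul_apply, mulVec, dotProduct]
  congr 2
  refine Fintype.sum_equiv σ.symm _ _ fun j => ?_
  simp [precedingPart, lowerTri]

theorem energySq_sub_smul {B : Matrix (Fin n) (Fin n) ℂ} (hB : B.IsHermitian)
    (e w : Fin n → ℂ) (ω : ℝ) :
    energySq B (e - (ω : ℂ) • w) =
      energySq B e - 2 * ω * (star w ⬝ᵥ (B *ᵥ e)).re + ω ^ 2 * energySq B w := by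
  have h : (star e ⬝ᵥ (B *ᵥ w)).re = (star w ⬝ᵥ (B *ᵥ e)).re := by
    rw [re_star_dotProduct_comm, star_mulVec, hB.eq, ← dotProduct_mulVec]
  simp only [energySq, star_sub, star_smul, mulVec_sub, mulVec_smul, sub_dotProduct,
    dotProduct_sub, smul_dotProduct, dotProduct_smul]
  simp
  rw [h]
  ring

theorem energySq_sorStepPerm {B : Matrix (Fin n) (Fin n) ℂ} (hB : B.IsHermitian)
    (hdiag : ∀ i, B i i = 1) (σ : Equiv.Perm (Fin n)) (ω : ℝ) (e w : Fin n → ℂ)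
    (hw : w + (ω : ℂ) • (precedingPart B σ *ᵥ w) = B *ᵥ e) :
    energySq B (e - (ω : ℂ) • w) = energySq B e - ω * (2 - ω) * (star w ⬝ᵥ w).re := by
  rw [energySq_sub_smul hB, ← hw]
  have h := two_mul_re_precedingPart hB hdiag σ w
  simp only [dotProduct_add, dotProduct_smul]
  simp
  linear_combination -ω ^ 2 * h

theorem re_star_dotProduct_self (v : Fin n → ℂ) :
    (star v ⬝ᵥ v).re = ∑ i, Complex.normSq (v i) := by
  simp [dotProduct, Complex.normSq_apply]

/-- Spectral calculus: quadratic forms in `B` and `B²` in an eigenbasis. -/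
theorem exists_eigen_weights {B : Matrix (Fin n) (Fin n) ℂ} (hB : B.IsHermitian) (v : Fin n → ℂ) :
    ∃ c : Fin n → ℝ, (∀ i, 0 ≤ c i) ∧ (star v ⬝ᵥ v).re = ∑ i, c i ∧
      energySq B v = ∑ i, hB.eigenvalues i * c i ∧
      (star (B *ᵥ v) ⬝ᵥ (B *ᵥ v)).re = ∑ i, hB.eigenvalues i ^ 2 * c i := by
  set U : Matrix (Fin n) (Fin n) ℂ := ↑hB.eigenvectorUnitary
  set z := Uᴴ *ᵥ v with hz
  have hUU : Uᴴ * U = 1 := Unitary.coe_star_mul_self hB.eigenvectorUnitary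
  have hUU' : U * Uᴴ = 1 := Unitary.coe_mul_star_self hB.eigenvectorUnitary
  have hv : v = U *ᵥ z := by rw [hz, mulVec_mulVec, hUU', one_mulVec]
  have hiso : ∀ x y : Fin n → ℂ, star (U *ᵥ x) ⬝ᵥ (U *ᵥ y) = star x ⬝ᵥ y := fun x y => by
    rw [star_mulVec, ← dotProduct_mulVec, mulVec_mulVec, hUU, one_mulVec]
  have hBv : B *ᵥ v = U *ᵥ (fun i => (hB.eigenvalues i : ℂ) * z i) := by
    conv_lhs => rw [hB.spectral_theorem, Unitary.conjStarAlgAut_apply]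
    rw [← mulVec_mulVec, ← mulVec_mulVec]
    congr 1
    funext i
    rw [mulVec_diagonal]
    rfl
  refine ⟨fun i => Complex.normSq (z i), fun i => Complex.normSq_nonneg _, ?_, ?_, ?_⟩
  · rw [hv, hiso, re_star_dotProduct_self]
  · rw [energySq, hBv]
    conv_lhs => rw [hv]
    rw [hiso]
    simp only [dotProduct, Complex.re_sum]
    refine Finset.sum_congr rfl fun i _ => ?_
    simp [Complex.normSq_apply]
    ring
  · rw [hBv, hiso, re_star_dotProduct_self]
    refine Finset.sum_congr rfl fun i _ => ?_
    rw [Complex.normSq_mul, Complex.normSq_ofReal, sq]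

/-- Exact value of `6 ∑_σ ‖T_σᴴ r‖²`, where `T_σ` is the preceding part of `B`. -/
theorem sum_normSq_precedingPart {B : Matrix (Fin n) (Fin n) ℂ} (hB : B.IsHermitian)
    (r : Fin n → ℂ) :
    6 * ∑ σ : Equiv.Perm (Fin n),
        (star ((precedingPart B σ)ᴴ *ᵥ r) ⬝ᵥ ((precedingPart B σ)ᴴ *ᵥ r)) =
      n.factorial * (2 * ∑ i, star (∑ j ∈ {i}ᶜ, B i j * r j) * (∑ j ∈ {i}ᶜ, B i j * r j) +
        ∑ i, ∑ j ∈ {i}ᶜ, star (B i j * r j) * (B i j * r j)) := by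
  have hT : ∀ σ i, ((precedingPart B σ)ᴴ *ᵥ r) i =
      ∑ j ∈ {i}ᶜ, (if σ.symm i < σ.symm j then (1 : ℂ) else 0) * (B i j * r j) := by
    intro σ i
    rw [mulVec, dotProduct, ← Finset.sum_subset (Finset.subset_univ {i}ᶜ)]
    · refine Finset.sum_congr rfl fun j _ => ?_
      by_cases h : σ.symm i < σ.symm j
      · have := hB.apply i j
        simp only [Complex.star_def] at this
        simp [precedingPart, h, this]
      · simp [precedingPart, h]
    · intro j _ hj
      have : j = i := by simpa using hj
      simp [this, precedingPart]
  simp only [dotProduct, Pi.star_apply, hT]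
  rw [Finset.sum_comm, Finset.mul_sum, Finset.mul_sum, ← Finset.sum_add_distrib, Finset.mul_sum]
  refine Finset.sum_congr rfl fun i _ => ?_
  simp only [star_sum, Finset.sum_mul_sum]
  rw [Finset.sum_comm, Finset.mul_sum, Finset.mul_sum, ← Finset.sum_add_distrib, Finset.mul_sum]
  refine Finset.sum_congr rfl fun j hj => ?_
  rw [Finset.sum_comm]
  have hkey : ∀ k ∈ ({i}ᶜ : Finset (Fin n)), 6 * ∑ σ : Equiv.Perm (Fin n),
      star ((if σ.symm i < σ.symm j then (1 : ℂ) else 0) * (B i j * r j)) *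
        ((if σ.symm i < σ.symm k then (1 : ℂ) else 0) * (B i k * r k)) =
      n.factorial * (2 * (star (B i j * r j) * (B i k * r k)) +
        if j = k then star (B i j * r j) * (B i k * r k) else 0) := by
    intro k hk
    have h := six_mul_sum_precedes i j k (by simpa using hj) (by simpa using hk)
    have : ∀ σ : Equiv.Perm (Fin n),
        star ((if σ.symm i < σ.symm j then (1 : ℂ) else 0) * (B i j * r j)) *
        ((if σ.symm i < σ.symm k then (1 : ℂ) else 0) * (B i k * r k)) =
        ((if σ.symm i < σ.symm j then (1 : ℂ) else 0) * if σ.symm i < σ.symm k then 1 else 0) *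
          (star (B i j * r j) * (B i k * r k)) := by
      intro σ
      split_ifs <;> simp
    simp only [this]
    rw [← Finset.sum_mul, ← mul_assoc, h]
    split_ifs <;> ring
  rw [Finset.mul_sum, Finset.sum_congr rfl hkey, ← Finset.mul_sum, Finset.sum_add_distrib,
    Finset.sum_ite_eq, if_pos hj, Finset.mul_sum]

/-- Averaged bound on `T_σᴴ r` in terms of a spectral bound for `B`. -/
theorem sum_re_normSq_precedingPart_le {B : Matrix (Fin n) (Fin n) ℂ} (hB : B.PosSemidef)
    (hdiag : ∀ i, B i i = 1) {lam : ℝ} (hlam : 1 ≤ lam)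
    (hbound : ∀ v : Fin n → ℂ, (star (B *ᵥ v) ⬝ᵥ (B *ᵥ v)).re ≤ lam * energySq B v)
    (hbound' : ∀ v : Fin n → ℂ, energySq B v ≤ lam * (star v ⬝ᵥ v).re)
    (r : Fin n → ℂ) :
    ∑ σ : Equiv.Perm (Fin n),
        (star ((precedingPart B σ)ᴴ *ᵥ r) ⬝ᵥ ((precedingPart B σ)ᴴ *ᵥ r)).re ≤
      n.factorial * (lam ^ 2 * (star r ⬝ᵥ r).re) := by
  have h := congrArg Complex.re (sum_normSq_precedingPart hB.1 r)
  have hoff : ∀ i, ∑ j ∈ {i}ᶜ, B i j * r j = (B *ᵥ r - r) i := by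
    intro i
    have : ∑ j, B i j * r j = _ := (Finset.sum_compl_add_sum {i} _).symm
    simp only [Pi.sub_apply, mulVec, dotProduct, this, Finset.sum_singleton, hdiag]
    ring
  have hre : ∀ z : ℂ, star z * z = (Complex.normSq z : ℂ) := fun z => by
    rw [Complex.star_def, Complex.normSq_eq_conj_mul_self]
  simp only [hoff, hre] at h
  norm_cast at h
  have hfst : ∑ i, Complex.normSq ((B *ᵥ r - r) i) ≤ (lam ^ 2 + 1) * (star r ⬝ᵥ r).re := by
    rw [← re_star_dotProduct_self]
    have hnn : 0 ≤ energySq B r := hB.re_dotProduct_nonneg r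
    have h1 := hbound r
    have h2 := mul_le_mul_of_nonneg_left (hbound' r) (zero_le_one.trans hlam)
    have h3 : (star (B *ᵥ r) ⬝ᵥ r).re = energySq B r := re_star_dotProduct_comm _ _
    have h4 : (star r ⬝ᵥ (B *ᵥ r)).re = energySq B r := rfl
    simp only [star_sub, sub_dotProduct, dotProduct_sub, Complex.sub_re, h3, h4]
    linarith
  have hcol : ∀ j, ∑ i, Complex.normSq (B i j) ≤ lam := by
    intro j
    have h1 := hbound (Pi.single j 1)
    have h2 : energySq B (Pi.single j 1) = 1 := by
      simp [energySq, hdiag]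
    rw [h2, re_star_dotProduct_self] at h1
    simpa using h1
  have hsnd : ∑ i, ∑ j ∈ {i}ᶜ, Complex.normSq (B i j * r j) ≤ lam * (star r ⬝ᵥ r).re := by
    calc ∑ i, ∑ j ∈ {i}ᶜ, Complex.normSq (B i j * r j)
        ≤ ∑ i, ∑ j, Complex.normSq (B i j * r j) := Finset.sum_le_sum fun i _ =>
          Finset.sum_le_sum_of_subset_of_nonneg (Finset.subset_univ _)
            fun j _ _ => Complex.normSq_nonneg _
      _ = ∑ j, (∑ i, Complex.normSq (B i j)) * Complex.normSq (r j) := by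
          rw [Finset.sum_comm]
          simp only [Complex.normSq_mul, Finset.sum_mul]
      _ ≤ ∑ j, lam * Complex.normSq (r j) := Finset.sum_le_sum fun j _ =>
          mul_le_mul_of_nonneg_right (hcol j) (Complex.normSq_nonneg _)
      _ = lam * (star r ⬝ᵥ r).re := by rw [← Finset.mul_sum, re_star_dotProduct_self]
  have hr : 0 ≤ (star r ⬝ᵥ r).re := by
    rw [re_star_dotProduct_self]
    exact Finset.sum_nonneg fun i _ => Complex.normSq_nonneg _
  have hsum : 2 * ∑ i, Complex.normSq ((B *ᵥ r - r) i) +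
      ∑ i, ∑ j ∈ {i}ᶜ, Complex.normSq (B i j * r j) ≤ 6 * (lam ^ 2 * (star r ⬝ᵥ r).re) := by
    have : 0 ≤ (4 * lam ^ 2 - 2 - lam) * (star r ⬝ᵥ r).re := mul_nonneg (by nlinarith) hr
    linarith
  have h6 := mul_le_mul_of_nonneg_left hsum (Nat.cast_nonneg (α := ℝ) n.factorial)
  rw [← h] at h6
  have h7 : ∀ z : ℂ, (6 * z).re = 6 * z.re := fun z => by simp
  rw [h7, Complex.re_sum] at h6
  linarith

theorem re_star_dotProduct_self_nonneg (v : Fin n → ℂ) : 0 ≤ (star v ⬝ᵥ v).re := by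
  rw [re_star_dotProduct_self]
  exact Finset.sum_nonneg fun i _ => Complex.normSq_nonneg _

/-- Lower bound on the average size of the corrections made by the sweeps. -/
theorem le_sum_re_normSq_correction {B : Matrix (Fin n) (Fin n) ℂ} (hB : B.PosSemidef)
    (hdiag : ∀ i, B i i = 1) {lam : ℝ} (hlam : 1 ≤ lam)
    (hbound : ∀ v : Fin n → ℂ, (star (B *ᵥ v) ⬝ᵥ (B *ᵥ v)).re ≤ lam * energySq B v)
    (hbound' : ∀ v : Fin n → ℂ, energySq B v ≤ lam * (star v ⬝ᵥ v).re)
    {ω : ℝ} (hω : 0 < ω) (r : Fin n → ℂ) (w : Equiv.Perm (Fin n) → Fin n → ℂ)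
    (hw : ∀ σ, w σ + (ω : ℂ) • (precedingPart B σ *ᵥ w σ) = r) :
    n.factorial * ((star r ⬝ᵥ r).re / (1 + ω * lam) ^ 2) ≤ ∑ σ, (star (w σ) ⬝ᵥ w σ).re := by
  set R := (star r ⬝ᵥ r).re with hR
  have hRnn : 0 ≤ R := re_star_dotProduct_self_nonneg r
  set t : ℝ := ((1 + ω * lam) ^ 2)⁻¹ with ht
  have hq : 0 < (1 + ω * lam) ^ 2 := by positivity
  have hσ : ∀ σ, 2 * t * R - t ^ 2 * (R + ω * (energySq B r - R) + ω ^ 2 *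
      (star ((precedingPart B σ)ᴴ *ᵥ r) ⬝ᵥ ((precedingPart B σ)ᴴ *ᵥ r)).re) ≤
      (star (w σ) ⬝ᵥ w σ).re := by
    intro σ
    set s := (precedingPart B σ)ᴴ *ᵥ r with hs
    have h1 := re_star_dotProduct_self_nonneg (w σ - (t : ℂ) • (r + (ω : ℂ) • s))
    have h2 : (star r ⬝ᵥ s).re = (star r ⬝ᵥ (precedingPart B σ *ᵥ r)).re :=
      re_star_dotProduct_conjTranspose_mulVec _ _
    have h3 := two_mul_re_precedingPart hB.1 hdiag σ r
    have h4 : (star r ⬝ᵥ w σ).re + ω * (star s ⬝ᵥ w σ).re = R := by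
      have : star s ⬝ᵥ w σ = star r ⬝ᵥ (precedingPart B σ *ᵥ w σ) := by
        rw [hs, star_mulVec, conjTranspose_conjTranspose, ← dotProduct_mulVec]
      rw [this, hR]
      conv_rhs => rw [← hw σ]
      rw [hw σ, ← hw σ, dotProduct_add, dotProduct_smul]
      simp
    have c1 : (star (w σ) ⬝ᵥ r).re = (star r ⬝ᵥ w σ).re := re_star_dotProduct_comm _ _
    have c2 : (star (w σ) ⬝ᵥ s).re = (star s ⬝ᵥ w σ).re := re_star_dotProduct_comm _ _
    have c3 : (star s ⬝ᵥ r).re = (star r ⬝ᵥ s).re := re_star_dotProduct_comm _ _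
    simp only [star_sub, star_add, star_smul, sub_dotProduct, dotProduct_sub, smul_dotProduct,
      dotProduct_smul, add_dotProduct, dotProduct_add] at h1
    simp [c1, c2, c3] at h1
    rw [← hR] at h1
    linear_combination h1 - 2 * t * h4 + t ^ 2 * ω * (2 * h2 + h3)
  have hsum := Finset.sum_le_sum fun σ (_ : σ ∈ Finset.univ) => hσ σ
  simp only [Finset.sum_sub_distrib, ← Finset.mul_sum, Finset.sum_add_distrib, Finset.sum_const, Finset.card_univ, Fintype.card_perm, Fintype.card_fin,
    nsmul_eq_mul] at hsum
  refine le_trans ?_ hsum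
  set N : ℝ := (n.factorial : ℝ)
  have hN : 0 ≤ N := Nat.cast_nonneg _
  have hG := sum_re_normSq_precedingPart_le hB hdiag hlam hbound hbound' r
  have hE : N * (ω * (energySq B r - R)) ≤ N * (ω * (lam * R)) := by
    have := hbound' r
    gcongr
    linarith
  have hG' := mul_le_mul_of_nonneg_left hG (sq_nonneg ω)
  have hNR : 0 ≤ N * (ω * (lam * R)) := by positivity
  have htot : N * (R + ω * (energySq B r - R)) + ω ^ 2 * ∑ σ : Equiv.Perm (Fin n),
      (star ((precedingPart B σ)ᴴ *ᵥ r) ⬝ᵥ ((precedingPart B σ)ᴴ *ᵥ r)).re ≤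
      (1 + ω * lam) ^ 2 * (N * R) := by
    linarith
  have htot' := mul_le_mul_of_nonneg_left htot (sq_nonneg t)
  have htq : t * (1 + ω * lam) ^ 2 = 1 := inv_mul_cancel₀ hq.ne'
  rw [div_eq_mul_inv, ← ht]
  linear_combination htot' + t * N * R * htq

/-- Averaged contraction of the energy in one sweep. -/
theorem sum_energySq_sorStepPerm_le {B : Matrix (Fin n) (Fin n) ℂ} (hB : B.PosSemidef)
    (hdiag : ∀ i, B i i = 1) {lam mu : ℝ} (hlam : 1 ≤ lam)
    (hbound : ∀ v : Fin n → ℂ, (star (B *ᵥ v) ⬝ᵥ (B *ᵥ v)).re ≤ lam * energySq B v)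
    (hbound' : ∀ v : Fin n → ℂ, energySq B v ≤ lam * (star v ⬝ᵥ v).re)
    (hmu : ∀ v : Fin n → ℂ, mu * energySq B v ≤ (star (B *ᵥ v) ⬝ᵥ (B *ᵥ v)).re)
    {ω : ℝ} (hω : 0 < ω) (hω2 : ω < 2) {b ybar : Fin n → ℂ} (hybar : B *ᵥ ybar = b)
    (v : Fin n → ℂ) :
    ∑ σ : Equiv.Perm (Fin n), energySq B (ybar - sorStepPerm B ω b σ v) ≤
      n.factorial * ((1 - ω * (2 - ω) * mu / (1 + ω * lam) ^ 2) * energySq B (ybar - v)) := by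
  choose w hstep hw using fun σ => exists_sorStepPerm_eq B ω b σ v
  have hres : b - B *ᵥ v = B *ᵥ (ybar - v) := by rw [mulVec_sub, hybar]
  have hterm : ∀ σ, energySq B (ybar - sorStepPerm B ω b σ v) =
      energySq B (ybar - v) - ω * (2 - ω) * (star (w σ) ⬝ᵥ w σ).re := fun σ => by
    rw [hstep, ← sub_sub, energySq_sorStepPerm hB.1 hdiag σ ω _ _ ((hw σ).trans hres)]
  simp only [hterm]
  rw [Finset.sum_sub_distrib, ← Finset.mul_sum]
  simp only [Finset.sum_const, Finset.card_univ, Fintype.card_perm, Fintype.card_fin,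
    nsmul_eq_mul]
  have h := le_sum_re_normSq_correction hB hdiag hlam hbound hbound' hω _ w
    fun σ => (hw σ).trans hres
  have hc : 0 ≤ ω * (2 - ω) := mul_nonneg hω.le (by linarith)
  have h1 : (n.factorial : ℝ) * (mu * energySq B (ybar - v) / (1 + ω * lam) ^ 2) ≤
      ∑ σ, (star (w σ) ⬝ᵥ w σ).re := by
    refine le_trans ?_ h
    have := hmu (ybar - v)
    gcongr
  have h2 := mul_le_mul_of_nonneg_left h1 hc
  linear_combination h2
end

/-- Theorem 4a: expected squared energy seminorm error bound for the shuffled SOR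
iteration, averaging over all (n!)^k sequences of permutations. -/
theorem shuffled_sor_expected_error_bound {n : ℕ} (B : Matrix (Fin n) (Fin n) ℂ)
    (hB : B.PosSemidef) (hdiag : ∀ i, B i i = 1)
    (lam1 lamr : ℝ)
    (hlam1 : IsGreatest {μ : ℝ | ∃ i, hB.1.eigenvalues i = μ} lam1)
    (hlamr : IsLeast {μ : ℝ | (∃ i, hB.1.eigenvalues i = μ) ∧ μ ≠ 0} lamr)
    (b : Fin n → ℂ) (hb : ∃ z, B *ᵥ z = b)
    (ybar : Fin n → ℂ) (hybar : B *ᵥ ybar = b)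
    (ω : ℝ) (hω0 : 0 < ω) (hω2 : ω < 2)
    (y0 : Fin n → ℂ)
    (y : ∀ k : ℕ, (Fin k → Equiv.Perm (Fin n)) → (Fin n → ℂ))
    (hy0 : ∀ σs, y 0 σs = y0)
    (hy : ∀ (k : ℕ) (σs : Fin (k+1) → Equiv.Perm (Fin n)),
      y (k+1) σs = sorStepPerm B ω b (σs (Fin.last k)) (y k (σs ∘ Fin.castSucc)))
    (k : ℕ) (hk : 1 ≤ k) :
    ((n.factorial : ℝ)^k)⁻¹ *
        ∑ σs : Fin k → Equiv.Perm (Fin n), energySq B (ybar - y k σs)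
      ≤ (1 - ω*(2-ω)*lam1 / ((1 + ω*lam1)^2 * (lam1/lamr)))^k * energySq B (ybar - y0) := by
  have hpos : ∀ i, 0 ≤ hB.1.eigenvalues i := hB.eigenvalues_nonneg
  have hle : ∀ i, hB.1.eigenvalues i ≤ lam1 := fun i => hlam1.2 ⟨i, rfl⟩
  obtain ⟨⟨i₀, hi₀⟩, hne⟩ := hlamr.1
  have hlamr0 : 0 < lamr := lt_of_le_of_ne (hi₀ ▸ hpos i₀) hne.symm
  have hlamr1 : lamr ≤ lam1 := hi₀ ▸ hle i₀
  have hbound' : ∀ v : Fin n → ℂ, energySq B v ≤ lam1 * (star v ⬝ᵥ v).re := fun v => by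
    obtain ⟨c, hc, h1, h2, -⟩ := exists_eigen_weights hB.1 v
    rw [h1, h2, Finset.mul_sum]
    exact Finset.sum_le_sum fun i _ => mul_le_mul_of_nonneg_right (hle i) (hc i)
  have hbound : ∀ v : Fin n → ℂ, (star (B *ᵥ v) ⬝ᵥ (B *ᵥ v)).re ≤ lam1 * energySq B v :=
    fun v => by
      obtain ⟨c, hc, -, h2, h3⟩ := exists_eigen_weights hB.1 v
      rw [h2, h3, Finset.mul_sum]
      refine Finset.sum_le_sum fun i _ => ?_
      rw [sq, mul_assoc]
      exact mul_le_mul_of_nonneg_right (hle i) (mul_nonneg (hpos i) (hc i))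
  have hmu : ∀ v : Fin n → ℂ, lamr * energySq B v ≤ (star (B *ᵥ v) ⬝ᵥ (B *ᵥ v)).re :=
    fun v => by
      obtain ⟨c, hc, -, h2, h3⟩ := exists_eigen_weights hB.1 v
      rw [h2, h3, Finset.mul_sum]
      refine Finset.sum_le_sum fun i _ => ?_
      rw [sq, mul_assoc]
      by_cases hi : hB.1.eigenvalues i = 0
      · simp [hi]
      · exact mul_le_mul_of_nonneg_right (hlamr.2 ⟨⟨i, rfl⟩, hi⟩) (mul_nonneg (hpos i) (hc i))
  have hlam : 1 ≤ lam1 := by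
    have h := hbound' (Pi.single i₀ 1)
    rw [re_star_dotProduct_self, Finset.sum_eq_single i₀ (by intro j _ hj; simp [hj])
      (by simp)] at h
    simpa [energySq, hdiag] using h
  have hfactor : ω*(2-ω)*lam1 / ((1 + ω*lam1)^2 * (lam1/lamr)) =
      ω * (2 - ω) * lamr / (1 + ω * lam1) ^ 2 := by
    have : 0 < 1 + ω * lam1 := by positivity
    field_simp
  rw [hfactor]
  set q := 1 - ω * (2 - ω) * lamr / (1 + ω * lam1) ^ 2 with hq
  have hq0 : 0 ≤ q := by
    rw [hq, sub_nonneg, div_le_one (by positivity)]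
    have h1 : ω * lamr ≤ ω * lam1 := mul_le_mul_of_nonneg_left hlamr1 hω0.le
    nlinarith [mul_pos (mul_pos hω0 hω0) hlamr0, sq_nonneg (ω * lam1)]
  have hN : (0 : ℝ) < n.factorial := by exact_mod_cast n.factorial_pos
  have main : ∀ m : ℕ, ∑ σs : Fin m → Equiv.Perm (Fin n), energySq B (ybar - y m σs) ≤
      (n.factorial * q) ^ m * energySq B (ybar - y0) := by
    intro m
    induction m with
    | zero => simp [hy0]
    | succ m ih =>
      calc ∑ σs : Fin (m + 1) → Equiv.Perm (Fin n), energySq B (ybar - y (m + 1) σs)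
          = ∑ τ : Fin m → Equiv.Perm (Fin n), ∑ σ : Equiv.Perm (Fin n),
              energySq B (ybar - sorStepPerm B ω b σ (y m τ)) := by
            rw [← (Fin.snocEquiv fun _ => Equiv.Perm (Fin n)).sum_comp, Fintype.sum_prod_type,
              Finset.sum_comm]
            refine Finset.sum_congr rfl fun τ _ => Finset.sum_congr rfl fun σ _ => ?_
            rw [hy]
            congr 3
            · simp [Fin.snocEquiv]
            · congr 1
              funext j
              simp [Fin.snocEquiv]
        _ ≤ ∑ τ : Fin m → Equiv.Perm (Fin n),
              n.factorial * (q * energySq B (ybar - y m τ)) := Finset.sum_le_sum fun τ _ =>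
            sum_energySq_sorStepPerm_le hB hdiag hlam hbound hbound' hmu hω0 hω2 hybar _
        _ = n.factorial * q * ∑ τ : Fin m → Equiv.Perm (Fin n), energySq B (ybar - y m τ) := by
            simp only [← mul_assoc, ← Finset.mul_sum]
        _ ≤ n.factorial * q * ((n.factorial * q) ^ m * energySq B (ybar - y0)) :=
            mul_le_mul_of_nonneg_left ih (mul_nonneg hN.le hq0)
        _ = _ := by ring
  rw [inv_mul_le_iff₀ (pow_pos hN k), ← mul_assoc, ← mul_pow]
  exact main k
end
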